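/- arXiv:2110.10856 — 4 statements merged into one kernel-verified Lean document; each statement's English description precedes it below -/
import Mathlib

section
/- Fix 0 < k < n and let P = (P_I), indexed by the k-element subsets I of [n], be a vector in ℝ^{C(n,k)}. Then P is a positive tropical Plücker vector — i.e., for every 1 ≤ a < b < c < d ≤ n and every (k−2)-element subset S of [n] disjoint from {a,b,c,d}, either P_{Sac}+P_{Sbd} = P_{Sab}+P_{Scd} ≤ P_{Sad}+P_{Sbc} or P_{Sac}+P_{Sbd} = P_{Sad}+P_{Sbc} ≤ P_{Sab}+P_{Scd} — if and only if every face of the regular subdivision D_P of the hypersimplex Δ_{k,n} is a positroid polytope, i.e., equals conv{e_B : B ∈ M} for some positroid M of rank k on [n]. -/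
noncomputable section

/-- The Pluecker coordinate of the full-rank `k x n` matrix `C` on the column set `S`
(the minor on the columns in `S`, taken in increasing order). -/
def pluck {k n : ℕ} (C : Matrix (Fin k) (Fin n) ℝ) (S : Finset (Fin n))
    (h : S.card = k) : ℝ :=
  (C.submatrix id (fun t => ((S.orderIsoOfFin h) t).val)).det

/-- The 0/1 indicator vector `e_S` of a subset `S` of `[n]`. -/
def eVec {n : ℕ} (S : Finset (Fin n)) : Fin n → ℝ :=
  fun i => if i ∈ S then 1 else 0

open Filter Topology

/-! ### Signs and three-term relations for maximal minors -/

/-- The minor of `C` on the columns `f 0, f 1, …`, in this order. -/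
def colDet {k n : ℕ} (C : Matrix (Fin k) (Fin n) ℝ) (f : Fin k → Fin n) : ℝ :=
  (C.submatrix id f).det

/-- The Vandermonde product of `f`; its sign is the sign of the permutation sorting `f`. -/
def vdm {k n : ℕ} (f : Fin k → Fin n) : ℝ :=
  (Matrix.vandermonde fun i => ((f i : ℕ) : ℝ)).det

/-- `pluck` extended by zero to sets of the wrong cardinality. -/
def pl {k n : ℕ} (C : Matrix (Fin k) (Fin n) ℝ) (S : Finset (Fin n)) : ℝ :=
  if h : S.card = k then pluck C S h else 0

section Minors

variable {k n : ℕ}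

lemma pl_eq_pluck (C : Matrix (Fin k) (Fin n) ℝ) {S : Finset (Fin n)} (h : S.card = k) :
    pl C S = pluck C S h := dif_pos h

lemma vdm_eq_prod (f : Fin k → Fin n) :
    vdm f = ∏ i, ∏ j ∈ Finset.Ioi i, (((f j : ℕ) : ℝ) - ((f i : ℕ) : ℝ)) :=
  Matrix.det_vandermonde _

lemma vdm_pos_of_strictMono {f : Fin k → Fin n} (hf : StrictMono f) : 0 < vdm f := by
  rw [vdm_eq_prod]
  refine Finset.prod_pos fun i _ => Finset.prod_pos fun j hj => sub_pos.2 ?_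
  exact_mod_cast hf (Finset.mem_Ioi.1 hj)

lemma vdm_ne_zero {f : Fin k → Fin n} (hf : Function.Injective f) : vdm f ≠ 0 := by
  refine Matrix.det_vandermonde_ne_zero_iff.2 fun i j hij => hf (Fin.ext ?_)
  exact_mod_cast hij

lemma vdm_comp_perm (f : Fin k → Fin n) (σ : Equiv.Perm (Fin k)) :
    vdm (f ∘ σ) = ((Equiv.Perm.sign σ : ℤ) : ℝ) * vdm f :=
  Matrix.det_permute σ (Matrix.vandermonde fun i => ((f i : ℕ) : ℝ))

lemma colDet_comp_perm (C : Matrix (Fin k) (Fin n) ℝ) (f : Fin k → Fin n)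
    (σ : Equiv.Perm (Fin k)) :
    colDet C (f ∘ σ) = ((Equiv.Perm.sign σ : ℤ) : ℝ) * colDet C f :=
  Matrix.det_permute' σ (C.submatrix id f)

lemma colDet_eq_zero (C : Matrix (Fin k) (Fin n) ℝ) {f : Fin k → Fin n}
    (hf : ¬ Function.Injective f) : colDet C f = 0 := by
  obtain ⟨i, j, hij, hne⟩ := Function.not_injective_iff.1 hf
  exact Matrix.det_zero_of_column_eq hne fun r => by simp [hij]

lemma pl_mul_abs_vdm (C : Matrix (Fin k) (Fin n) ℝ) {f : Fin k → Fin n}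
    (hf : Function.Injective f) {S : Finset (Fin n)} (h : S.card = k) (hS : ∀ i, f i ∈ S) :
    pl C S * |vdm f| = colDet C f * vdm f := by
  set g : Fin k → Fin n := fun t => ((S.orderIsoOfFin h) t).val with hg
  have hgm : StrictMono g := fun i j hij => (S.orderIsoOfFin h).strictMono hij
  let τ : Fin k → Fin k := fun i => (S.orderIsoOfFin h).symm ⟨f i, hS i⟩
  have hτ : Function.Injective τ := fun i j hij => hf (by
    simpa [τ] using hij)
  let σ : Equiv.Perm (Fin k) := Equiv.ofBijective τ (Finite.injective_iff_bijective.1 hτ)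
  have hfg : f = g ∘ σ := by
    funext i
    exact (congrArg Subtype.val ((S.orderIsoOfFin h).apply_symm_apply ⟨f i, hS i⟩)).symm
  have hpl : pl C S = colDet C g := pl_eq_pluck C h
  have hpos := vdm_pos_of_strictMono hgm
  rw [hfg, vdm_comp_perm, colDet_comp_perm, hpl]
  rcases Int.units_eq_one_or (Equiv.Perm.sign σ) with hs | hs <;> simp [hs, abs_of_pos hpos]

lemma pl_eq_colDet (C : Matrix (Fin k) (Fin n) ℝ) {f : Fin k → Fin n}
    (hf : StrictMono f) {S : Finset (Fin n)} (h : S.card = k) (hS : ∀ i, f i ∈ S) :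
    pl C S = colDet C f := by
  have h1 := pl_mul_abs_vdm C hf.injective h hS
  have hpos := vdm_pos_of_strictMono hf
  rw [abs_of_pos hpos] at h1
  exact mul_right_cancel₀ hpos.ne' h1

lemma cramer_submatrix (C : Matrix (Fin k) (Fin n) ℝ) (f : Fin k → Fin n) (c : Fin n)
    (i : Fin k) :
    Matrix.cramer (C.submatrix id f) (C.col c) i = colDet C (Function.update f i c) := by
  rw [Matrix.cramer_apply, colDet]
  congr 1
  ext r t
  by_cases h : t = i <;> simp [h]

lemma colDet_three_term (C : Matrix (Fin (k + 2)) (Fin n) ℝ) (u : Fin k → Fin n)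
    (a b c d : Fin n) :
    colDet C (Fin.cons a (Fin.cons c u : Fin (k + 1) → Fin n)) *
        colDet C (Fin.cons b (Fin.cons d u : Fin (k + 1) → Fin n)) =
      colDet C (Fin.cons a (Fin.cons b u : Fin (k + 1) → Fin n)) *
        colDet C (Fin.cons c (Fin.cons d u : Fin (k + 1) → Fin n)) +
      colDet C (Fin.cons a (Fin.cons d u : Fin (k + 1) → Fin n)) *
        colDet C (Fin.cons b (Fin.cons c u : Fin (k + 1) → Fin n)) := by
  set f : Fin (k + 2) → Fin n := Fin.cons a (Fin.cons b u : Fin (k + 1) → Fin n) with hf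
  set g : Fin (k + 2) → Fin n := Fin.cons c (Fin.cons d u : Fin (k + 1) → Fin n) with hg
  have hcol : ∀ x, colDet C (Fin.cons x (Fin.cons d u : Fin (k + 1) → Fin n)) =
      Matrix.cramer (C.submatrix id g) (C.col x) 0 := fun x => by
    rw [cramer_submatrix, hg, Fin.update_cons_zero]
  have key := congrArg (fun w => Matrix.cramer (C.submatrix id g) w 0)
    (Matrix.mulVec_cramer (C.submatrix id f) (C.col c))
  simp only [map_smul, Pi.smul_apply, smul_eq_mul] at key
  rw [Matrix.mulVec_eq_sum, map_sum, Finset.sum_apply, Fin.sum_univ_succ, Fin.sum_univ_succ,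
    Finset.sum_eq_zero] at key
  · have hsw : colDet C (Fin.cons c (Fin.cons b u : Fin (k + 1) → Fin n)) =
        - colDet C (Fin.cons b (Fin.cons c u : Fin (k + 1) → Fin n)) := by
      have := colDet_comp_perm C (Fin.cons b (Fin.cons c u : Fin (k + 1) → Fin n))
        (Equiv.swap 0 1)
      rw [Equiv.Perm.sign_swap (by simp)] at this
      have h2 : (Fin.cons b (Fin.cons c u : Fin (k + 1) → Fin n) : Fin (k + 2) → Fin n) ∘
          (Equiv.swap 0 1) = Fin.cons c (Fin.cons b u : Fin (k + 1) → Fin n) := by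
        ext i
        refine Fin.cases ?_ (fun i => Fin.cases ?_ (fun i => ?_) i) i
        · rw [Function.comp, Equiv.swap_apply_left]
          rfl
        · rw [Function.comp, show Fin.succ 0 = (1 : Fin (k + 2)) from rfl,
            Equiv.swap_apply_right]
          rfl
        · rw [Function.comp, Equiv.swap_apply_of_ne_of_ne (Fin.succ_ne_zero _)
            (by rw [← Fin.succ_zero_eq_one]; simp [Fin.ext_iff])]
          simp
      rw [h2] at this
      simpa using this
    have e0 : Matrix.cramer (C.submatrix id f) (C.col c) 0 =
        colDet C (Fin.cons c (Fin.cons b u : Fin (k + 1) → Fin n)) := by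
      rw [cramer_submatrix, hf, Fin.update_cons_zero]
    have e1 : Matrix.cramer (C.submatrix id f) (C.col c) (Fin.succ 0) =
        colDet C (Fin.cons a (Fin.cons c u : Fin (k + 1) → Fin n)) := by
      rw [cramer_submatrix, hf, ← Fin.cons_update, Fin.update_cons_zero]
    have hT : ∀ t, (C.submatrix id f).transpose t = C.col (f t) := fun t => rfl
    simp only [op_smul_eq_smul, map_smul, Pi.smul_apply, smul_eq_mul, hT, e0, e1,
      ← hcol] at key
    have f0 : f 0 = a := rfl
    have f1 : f (Fin.succ 0) = b := rfl
    rw [f0, f1, hsw] at key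
    have hdet : (C.submatrix id f).det = colDet C f := rfl
    rw [hdet, ← hg] at key
    linarith
  · intro t _
    have hT : (C.submatrix id f).transpose t.succ.succ = C.col (u t) := rfl
    rw [op_smul_eq_smul, map_smul, Pi.smul_apply, hT, ← hcol, colDet_eq_zero,
      smul_zero]
    intro hinj
    have : (0 : Fin (k + 2)) = t.succ.succ := hinj (by simp)
    exact Fin.succ_ne_zero _ this.symm

lemma vdm_cons {f : Fin k → Fin n} (x : Fin n) :
    vdm (Fin.cons x f : Fin (k + 1) → Fin n) =
      (∏ j, (((f j : ℕ) : ℝ) - ((x : ℕ) : ℝ))) * vdm f := by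
  rw [vdm_eq_prod, vdm_eq_prod, Fin.prod_univ_succ]
  simp

lemma card_insert_insert {S : Finset (Fin n)} {x y : Fin n} (hS : S.card + 2 = k)
    (hxy : x ≠ y) (hx : x ∉ S) (hy : y ∉ S) : (insert x (insert y S)).card = k := by
  rw [Finset.card_insert_of_notMem (by simp [hxy, hx]), Finset.card_insert_of_notMem hy, ← hS]

lemma pl_three_term (C : Matrix (Fin k) (Fin n) ℝ) {a b c d : Fin n} (hab : a < b) (hbc : b < c)
    (hcd : c < d) {S : Finset (Fin n)} (hS : S.card + 2 = k) (ha : a ∉ S) (hb : b ∉ S)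
    (hc : c ∉ S) (hd : d ∉ S) :
    pl C (insert a (insert c S)) * pl C (insert b (insert d S)) =
      pl C (insert a (insert b S)) * pl C (insert c (insert d S)) +
      pl C (insert a (insert d S)) * pl C (insert b (insert c S)) := by
  subst hS
  let u : Fin S.card → Fin n := fun i => S.orderEmbOfFin rfl i
  have huS : ∀ i, u i ∈ S := fun i => Finset.orderEmbOfFin_mem S rfl i
  let g : Fin n → ℝ := fun x => ∏ j, (((u j : ℕ) : ℝ) - ((x : ℕ) : ℝ))
  have hg : ∀ x, x ∉ S → g x ≠ 0 := fun x hx => by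
    refine Finset.prod_ne_zero_iff.2 fun j _ => sub_ne_zero.2 fun h => hx ?_
    have : u j = x := Fin.ext (by exact_mod_cast h)
    exact this ▸ huS j
  have hu0 : vdm u ≠ 0 := vdm_ne_zero (S.orderEmbOfFin rfl).injective
  have hs : ∀ r : ℝ, r ≠ 0 → r / |r| * (r / |r|) = 1 := fun r hr => by
    rw [div_mul_div_comm, abs_mul_abs_self, div_self (mul_ne_zero hr hr)]
  have main : ∀ x y, x < y → x ∉ S → y ∉ S → pl C (insert x (insert y S)) =
      colDet C (Fin.cons x (Fin.cons y u : Fin (S.card + 1) → Fin n)) *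
        (g x / |g x|) * (g y / |g y|) * (vdm u / |vdm u|) := by
    intro x y hxy hx hy
    have hinj : Function.Injective
        (Fin.cons x (Fin.cons y u : Fin (S.card + 1) → Fin n) : Fin (S.card + 2) → Fin n) := by
      rw [Fin.cons_injective_iff, Fin.cons_injective_iff]
      refine ⟨?_, ?_, (S.orderEmbOfFin rfl).injective⟩
      · rintro ⟨i, hi⟩
        revert hi
        refine Fin.cases ?_ (fun i => ?_) i
        · simpa using hxy.ne'
        · intro hi
          exact hx (hi ▸ huS i)
      · rintro ⟨i, hi⟩
        exact hy (hi ▸ huS i)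
    have h1 := pl_mul_abs_vdm C hinj (card_insert_insert rfl hxy.ne hx hy) (fun i => by
      refine Fin.cases ?_ (fun i => Fin.cases ?_ (fun i => ?_) i) i
      · simp
      · simp
      · simp [huS])
    have hv : vdm (Fin.cons x (Fin.cons y u : Fin (S.card + 1) → Fin n) :
        Fin (S.card + 2) → Fin n) = (((y : ℕ) : ℝ) - ((x : ℕ) : ℝ)) * g x * (g y * vdm u) := by
      rw [vdm_cons, vdm_cons, Fin.prod_univ_succ]
      rfl
    have hyx : (0 : ℝ) < ((y : ℕ) : ℝ) - ((x : ℕ) : ℝ) := sub_pos.2 (by exact_mod_cast hxy)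
    rw [hv] at h1
    simp only [abs_mul, abs_of_pos hyx] at h1
    have := hg x hx
    have := hg y hy
    field_simp
    have h2 := mul_left_cancel₀ hyx.ne' (a := ((y : ℕ) : ℝ) - ((x : ℕ) : ℝ))
      (b := pl C (insert x (insert y S)) * (|g x| * (|g y| * |vdm u|)))
      (c := colDet C (Fin.cons x (Fin.cons y u : Fin (S.card + 1) → Fin n)) *
        (g x * (g y * vdm u))) (by linarith)
    linarith
  have hac := hab.trans hbc
  have hbd := hbc.trans hcd
  rw [main a c hac ha hc, main b d hbd hb hd, main a b hab ha hb, main c d hcd hc hd,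
    main a d (hac.trans hcd) ha hd, main b c hbc hb hc]
  linear_combination (g a / |g a|) * (g b / |g b|) * (g c / |g c|) * (g d / |g d|) *
    (vdm u / |vdm u|) ^ 2 * colDet_three_term C u a b c d

end Minors

/-! ### Exponential asymptotics -/

/-- `f` is positive and asymptotic to `c * exp (-a s)` for some `c > 0`. -/
def HasLead (f : ℝ → ℝ) (a : ℝ) : Prop :=
  (∀ s, 0 < f s) ∧ ∃ c, 0 < c ∧ Tendsto (fun s => f s * Real.exp (a * s)) atTop (𝓝 c)

namespace HasLead

variable {f g : ℝ → ℝ} {a b : ℝ}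

lemma exp (a : ℝ) : HasLead (fun s => Real.exp (-(a * s))) a := by
  refine ⟨fun s => Real.exp_pos _, 1, one_pos, ?_⟩
  simp [← Real.exp_add]

lemma mul (hf : HasLead f a) (hg : HasLead g b) : HasLead (fun s => f s * g s) (a + b) := by
  obtain ⟨hf, c, hc, hfc⟩ := hf
  obtain ⟨hg, d, hd, hgd⟩ := hg
  refine ⟨fun s => mul_pos (hf s) (hg s), c * d, mul_pos hc hd, (hfc.mul hgd).congr fun s => ?_⟩
  rw [add_mul, Real.exp_add]
  ring

lemma div (hf : HasLead f a) (hg : HasLead g b) : HasLead (fun s => f s / g s) (a - b) := by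
  obtain ⟨hf, c, hc, hfc⟩ := hf
  obtain ⟨hg, d, hd, hgd⟩ := hg
  refine ⟨fun s => div_pos (hf s) (hg s), c / d, div_pos hc hd,
    (hfc.div hgd hd.ne').congr fun s => ?_⟩
  rw [Pi.div_apply, sub_mul, Real.exp_sub, mul_div_mul_comm]

lemma tendsto_zero (hf : HasLead f a) (hba : b < a) :
    Tendsto (fun s => f s * Real.exp (b * s)) atTop (𝓝 0) := by
  obtain ⟨-, c, -, hfc⟩ := hf
  have h0 : Tendsto (fun s : ℝ => Real.exp ((b - a) * s)) atTop (𝓝 0) :=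
    Real.tendsto_exp_atBot.comp (tendsto_id.const_mul_atTop_of_neg (sub_neg.2 hba))
  have := hfc.mul h0
  rw [mul_zero] at this
  refine this.congr fun s => ?_
  rw [mul_assoc, ← Real.exp_add]
  ring_nf

lemma add_of_le (hf : HasLead f a) (hg : HasLead g b) (hab : a ≤ b) :
    HasLead (fun s => f s + g s) a := by
  refine ⟨fun s => add_pos (hf.1 s) (hg.1 s), ?_⟩
  obtain ⟨-, c, hc, hfc⟩ := hf
  rcases hab.eq_or_lt with rfl | hab
  · obtain ⟨-, d, hd, hgd⟩ := hg
    exact ⟨c + d, add_pos hc hd, (hfc.add hgd).congr fun s => by ring⟩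
  · refine ⟨c, hc, ?_⟩
    have := hfc.add (hg.tendsto_zero hab)
    rw [add_zero] at this
    exact this.congr fun s => by ring

end HasLead

/-! ### Positive tropical Plücker vectors lift to totally positive matrices -/

/-- The three-term positive tropical Plücker relations. -/
def IsPosTrop (k : ℕ) {n : ℕ} (P : Finset (Fin n) → ℝ) : Prop :=
  ∀ a b c d : Fin n, a < b → b < c → c < d →
      ∀ S : Finset (Fin n), S.card + 2 = k →
        a ∉ S → b ∉ S → c ∉ S → d ∉ S →
        ((P (insert a (insert c S)) + P (insert b (insert d S)) =
            P (insert a (insert b S)) + P (insert c (insert d S)) ∧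
          P (insert a (insert b S)) + P (insert c (insert d S)) ≤
            P (insert a (insert d S)) + P (insert b (insert c S))) ∨
        (P (insert a (insert c S)) + P (insert b (insert d S)) =
            P (insert a (insert d S)) + P (insert b (insert c S)) ∧
          P (insert a (insert d S)) + P (insert b (insert c S)) ≤
            P (insert a (insert b S)) + P (insert c (insert d S))))

section Lift

variable {k n : ℕ} {P : Finset (Fin n) → ℝ}

lemma sum_insert_insert (l : Fin n → ℝ) {S : Finset (Fin n)} {x y : Fin n}
    (hxy : x ≠ y) (hx : x ∉ S) (hy : y ∉ S) :
    ∑ i ∈ insert x (insert y S), l i = l x + l y + ∑ i ∈ S, l i := by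
  rw [Finset.sum_insert (by simp [hxy, hx]), Finset.sum_insert hy, add_assoc]

lemma IsPosTrop.add_linear (hP : IsPosTrop k P) (l : Fin n → ℝ) :
    IsPosTrop k (fun S => (∑ i ∈ S, l i) + P S) := by
  intro a b c d hab hbc hcd S hS ha hb hc hd
  have hac := hab.trans hbc
  have hbd := hbc.trans hcd
  simp only [sum_insert_insert l hab.ne ha hb, sum_insert_insert l hac.ne ha hc,
    sum_insert_insert l (hac.trans hcd).ne ha hd, sum_insert_insert l hbc.ne hb hc,
    sum_insert_insert l hbd.ne hb hd, sum_insert_insert l hcd.ne hc hd]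
  rcases hP a b c d hab hbc hcd S hS ha hb hc hd with ⟨h1, h2⟩ | ⟨h1, h2⟩
  · left; constructor <;> linarith
  · right; constructor <;> linarith

/-- The Plücker coordinates of the family `C` have the asymptotics prescribed by `P` on the
subsets of the first `m` columns. -/
def LiftsBelow (P : Finset (Fin n) → ℝ) (C : ℝ → Matrix (Fin k) (Fin n) ℝ) (m : ℕ) : Prop :=
  ∀ I : Finset (Fin n), I.card = k → (∀ x ∈ I, x.val < m) → HasLead (fun s => pl (C s) I) (P I)

/-- The union of an initial interval and an interval of `Fin n`. -/
def twoIntervals (n i j m : ℕ) : Finset (Fin n) :=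
  Finset.univ.filter fun x => x.val < i ∨ (j ≤ x.val ∧ x.val < m)

lemma mem_twoIntervals {i j m : ℕ} {x : Fin n} :
    x ∈ twoIntervals n i j m ↔ x.val < i ∨ (j ≤ x.val ∧ x.val < m) := by
  simp [twoIntervals]

lemma card_twoIntervals {i j m : ℕ} (hij : i ≤ j) (hjm : j ≤ m) (hm : m ≤ n) :
    (twoIntervals n i j m).card = i + (m - j) := by
  have h : (twoIntervals n i j m).map Fin.valEmbedding = Finset.range i ∪ Finset.Ico j m := by
    ext x
    simp only [Finset.mem_map, mem_twoIntervals, Fin.valEmbedding_apply, Finset.mem_union,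
      Finset.mem_range, Finset.mem_Ico]
    constructor
    · rintro ⟨y, hy, rfl⟩
      exact hy
    · intro hx
      exact ⟨⟨x, by omega⟩, hx, rfl⟩
  rw [← Finset.card_map Fin.valEmbedding, h, Finset.card_union_of_disjoint]
  · simp
  · rw [Finset.disjoint_left]
    intro x
    simp only [Finset.mem_range, Finset.mem_Ico]
    omega

/-- The three-term relation determines the asymptotics at `Sbd` from the other five terms. -/
lemma IsPosTrop.hasLead_three_term (hP : IsPosTrop k P) {C : ℝ → Matrix (Fin k) (Fin n) ℝ}
    {a b c d : Fin n} (hab : a < b) (hbc : b < c)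
    (hcd : c < d) {S : Finset (Fin n)} (hS : S.card + 2 = k) (ha : a ∉ S) (hb : b ∉ S)
    (hc : c ∉ S) (hd : d ∉ S)
    (h : ∀ x y, (x, y) ∈ [(a, c), (a, b), (c, d), (a, d), (b, c)] →
      HasLead (fun s => pl (C s) (insert x (insert y S))) (P (insert x (insert y S)))) :
    HasLead (fun s => pl (C s) (insert b (insert d S))) (P (insert b (insert d S))) := by
  have hac := h a c (by simp)
  have h1 := (h a b (by simp)).mul (h c d (by simp))
  have h2 := (h a d (by simp)).mul (h b c (by simp))
  have hfun : (fun s => pl (C s) (insert b (insert d S))) = fun s =>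
      (pl (C s) (insert a (insert b S)) * pl (C s) (insert c (insert d S)) +
      pl (C s) (insert a (insert d S)) * pl (C s) (insert b (insert c S))) /
        pl (C s) (insert a (insert c S)) := by
    funext s
    rw [← pl_three_term (C s) hab hbc hcd hS ha hb hc hd, mul_div_cancel_left₀ _ (hac.1 s).ne']
  rw [hfun]
  rcases hP a b c d hab hbc hcd S hS ha hb hc hd with ⟨e1, e2⟩ | ⟨e1, e2⟩
  · have := (h1.add_of_le h2 e2).div hac
    rwa [← e1, add_sub_cancel_left] at this
  · have := (h2.add_of_le h1 e2).div hac
    rw [← e1, add_sub_cancel_left] at this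
    simpa only [add_comm] using this

/-- A lift below `m` extends to `m + 1` once the asymptotics hold for those sets which are the
union of an initial interval and an interval ending in `m`. -/
lemma IsPosTrop.liftsBelow_succ (hP : IsPosTrop k P) {C : ℝ → Matrix (Fin k) (Fin n) ℝ} {m : ℕ}
    (hkm : k ≤ m) (hm : m < n) (hC : LiftsBelow P C m)
    (hcl : ∀ i < k, HasLead (fun s => pl (C s) (twoIntervals n i (m + 1 + i - k) (m + 1)))
      (P (twoIntervals n i (m + 1 + i - k) (m + 1)))) :
    LiftsBelow P C (m + 1) := by
  intro I hI hIm
  by_cases hmI : (⟨m, hm⟩ : Fin n) ∈ I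
  swap
  · refine hC I hI fun x hx => ?_
    have : x.val ≠ m := fun h => hmI (by convert hx; exact h.symm)
    have := hIm x hx
    omega
  suffices H : ∀ e i : ℕ, e + i = k → ∀ t : ℕ, ∀ I : Finset (Fin n), ∑ x ∈ I, (n - x.val) = t →
      I.card = k → (∀ x ∈ I, x.val < m + 1) → (⟨m, hm⟩ : Fin n) ∈ I →
      (∀ x : Fin n, x.val < i → x ∈ I) → HasLead (fun s => pl (C s) I) (P I) from
    H k 0 rfl _ I rfl hI hIm hmI fun x hx => absurd hx (Nat.not_lt_zero _)
  clear hmI hIm hI I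
  intro e
  induction e with
  | zero =>
    intro i hi t I _ hI _ hmI hiI
    exfalso
    have hsub : insert (⟨m, hm⟩ : Fin n) (twoIntervals n i m m) ⊆ I := by
      intro x hx
      rw [Finset.mem_insert, mem_twoIntervals] at hx
      rcases hx with rfl | hx
      · exact hmI
      · exact hiI x (by omega)
    have h1 := Finset.card_le_card hsub
    rw [Finset.card_insert_of_notMem (by rw [mem_twoIntervals]; simp; omega),
      card_twoIntervals (by omega) le_rfl hm.le] at h1
    omega
  | succ e ihe =>
    intro i hi t
    induction t using Nat.strong_induction_on with
    | _ t iht =>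
    intro I hIt hI hIm hmI hiI
    set d : Fin n := ⟨m, hm⟩ with hd
    set a : Fin n := ⟨i, by omega⟩ with ha
    by_cases haI : a ∈ I
    · refine ihe (i + 1) (by omega) t I hIt hI hIm hmI fun x hx => ?_
      rcases Nat.lt_succ_iff_lt_or_eq.1 hx with h | h
      · exact hiI x h
      · rwa [show x = a from Fin.ext h]
    obtain ⟨b, hbI, hbmin⟩ := (I.filter fun x => a ≤ x).exists_min_image id
      ⟨d, Finset.mem_filter.2 ⟨hmI, show i ≤ m by omega⟩⟩
    simp only [Finset.mem_filter, id] at hbI hbmin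
    have hab : a < b := lt_of_le_of_ne hbI.2 fun h => haI (h ▸ hbI.1)
    by_cases hgap : ∃ c, b < c ∧ c < d ∧ c ∉ I
    · obtain ⟨c, hbc, hcd, hcI⟩ := hgap
      have hbd := hbc.trans hcd
      set S := (I.erase d).erase b with hS
      have hI' : insert b (insert d S) = I := by
        rw [hS, Finset.insert_comm, Finset.insert_erase, Finset.insert_erase hmI]
        simp [hbI.1, hbd.ne]
      have hbS : b ∉ S := by simp [hS]
      have hdS : d ∉ S := by simp [hS]
      have haS : a ∉ S := fun h => haI (by simp [hS] at h; exact h.2.2)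
      have hcS : c ∉ S := fun h => hcI (by simp [hS] at h; exact h.2.2)
      have hScard : S.card + 2 = k := by
        rw [← hI, ← hI', Finset.card_insert_of_notMem (by simp [hbd.ne, hbS]),
          Finset.card_insert_of_notMem hdS]
      have hSm : ∀ x ∈ S, x.val < m := fun x hx => by
        have h1 := hIm x (by rw [← hI']; simp [hx])
        have h2 : x ≠ d := fun h => hdS (h ▸ hx)
        have h3 : x.val ≠ m := fun h => h2 (Fin.ext h)
        omega
      have hiS : ∀ x : Fin n, x.val < i → x ∈ S := fun x hx => by
        have h1 := hiI x hx
        have h2 : x < a := hx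
        simp [hS, h1, (h2.trans hab).ne, (h2.trans (hab.trans hbd)).ne]
      have hlow : ∀ x y : Fin n, x < y → y < d → x ∉ S → y ∉ S →
          HasLead (fun s => pl (C s) (insert x (insert y S))) (P (insert x (insert y S))) := by
        intro x y hxy hyd hx hy
        refine hC _ (card_insert_insert hScard hxy.ne hx hy) fun z hz => ?_
        simp only [Finset.mem_insert] at hz
        rcases hz with rfl | rfl | hz
        · exact hxy.trans hyd
        · exact hyd
        · exact hSm z hz
      have hup : ∀ x : Fin n, x < d → ∀ z ∈ insert x (insert d S), z.val < m + 1 := by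
        intro x hx z hz
        simp only [Finset.mem_insert] at hz
        rcases hz with rfl | rfl | hz
        · exact Nat.lt_succ_of_lt hx
        · exact Nat.lt_succ_self m
        · exact Nat.lt_succ_of_lt (hSm z hz)
      have had := hab.trans hbd
      rw [← hI']
      refine hP.hasLead_three_term hab hbc hcd hScard haS hbS hcS hdS fun x y hxy => ?_
      simp only [List.mem_cons, Prod.mk.injEq, List.not_mem_nil, or_false] at hxy
      rcases hxy with ⟨rfl, rfl⟩ | ⟨rfl, rfl⟩ | ⟨rfl, rfl⟩ | ⟨rfl, rfl⟩ | ⟨rfl, rfl⟩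
      · exact hlow _ _ (hab.trans hbc) hcd haS hcS
      · exact hlow _ _ hab hbd haS hbS
      · refine iht _ ?_ _ rfl (card_insert_insert hScard hcd.ne hcS hdS) (hup _ hcd) (by simp)
          fun z hz => by simp [hiS z hz]
        rw [← hIt, ← hI', Finset.sum_insert (a := b) (by simp [hbd.ne, hbS]),
          Finset.sum_insert (a := x) (by simp [hcd.ne, hcS])]
        have := x.isLt
        have : b.val < x.val := hbc
        omega
      · refine ihe (i + 1) (by omega) _ _ rfl (card_insert_insert hScard had.ne haS hdS)
          (hup _ had) (by simp) fun z hz => ?_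
        rcases Nat.lt_succ_iff_lt_or_eq.1 hz with h | h
        · simp [hiS z h]
        · simp [show z = a from Fin.ext h]
      · exact hlow _ _ hbc hcd hbS hcS
    · push Not at hgap
      have hIeq : I = twoIntervals n i b.val (m + 1) := by
        ext x
        rw [mem_twoIntervals]
        constructor
        · intro hx
          rcases lt_or_ge x a with h | h
          · exact Or.inl h
          · exact Or.inr ⟨hbmin x ⟨hx, h⟩, hIm x hx⟩
        · rintro (h | ⟨h1, h2⟩)
          · exact hiI x h
          · rcases (show b ≤ x from h1).eq_or_lt with rfl | h1
            · exact hbI.1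
            rcases Nat.lt_succ_iff_lt_or_eq.1 h2 with h2 | h2
            · exact hgap x h1 h2
            · rwa [show x = d from Fin.ext h2]
      have hbm : b.val < m + 1 := hIm b hbI.1
      have hib : i < b.val := hab
      have hcard := card_twoIntervals (n := n) hib.le hbm.le hm
      rw [← hIeq, hI] at hcard
      have hb : b.val = m + 1 + i - k := by omega
      rw [hIeq, hb]
      exact hcl i (by omega)

end Lift

section Construction

variable {k n : ℕ} {P : Finset (Fin n) → ℝ}

lemma pl_updateCol_of_notMem (C : Matrix (Fin k) (Fin n) ℝ) {m : Fin n} (w : Fin k → ℝ)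
    {I : Finset (Fin n)} (hm : m ∉ I) : pl (C.updateCol m w) I = pl C I := by
  by_cases h : I.card = k
  · rw [pl_eq_pluck _ h, pl_eq_pluck _ h, pluck, pluck]
    congr 1
    ext i t
    have : ((I.orderIsoOfFin h) t).val ≠ m := fun e => hm (e ▸ ((I.orderIsoOfFin h) t).2)
    simp only [Matrix.submatrix_apply, Matrix.updateCol_apply, if_neg this]
  · simp [pl, h]

/-- The column `m` can be chosen so that the Plücker coordinates at the sets which are the union
of an initial interval and an interval ending in `m` take arbitrary prescribed values. -/
lemma exists_column (C : Matrix (Fin k) (Fin n) ℝ) {m : ℕ} (hkm : k ≤ m) (hm : m < n)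
    (hC : ∀ I : Finset (Fin n), I.card = k → (∀ x ∈ I, x.val < m) → pl C I ≠ 0)
    (y : ℕ → ℝ) :
    ∃ w : Fin k → ℝ, ∀ i < k,
      pl (C.updateCol ⟨m, hm⟩ w) (twoIntervals n i (m + 1 + i - k) (m + 1)) = y i := by
  obtain _ | k := k
  · exact ⟨0, fun i hi => absurd hi (Nat.not_lt_zero _)⟩
  set d : Fin n := ⟨m, hm⟩ with hd
  have hR : ∀ i : Fin (k + 1), (twoIntervals n i.val (m + 1 + i - (k + 1)) m).card = k :=
    fun i => by
      rw [card_twoIntervals (by omega) (by omega) hm.le]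
      omega
  let r : Fin (k + 1) → Fin k → Fin n :=
    fun i t => (twoIntervals n i.val (m + 1 + i - (k + 1)) m).orderEmbOfFin (hR i) t
  have hr : ∀ (i : Fin (k + 1)) (t : Fin k), r i t ∈ twoIntervals n i.val (m + 1 + i - (k + 1)) m :=
    fun i t => Finset.orderEmbOfFin_mem _ _ _
  have hrm : ∀ (i : Fin (k + 1)) (t : Fin k), (r i t).val < i.val ∨ (m + 1 + i - (k + 1) ≤ (r i t).val ∧ (r i t).val < m) :=
    fun i t => mem_twoIntervals.1 (hr i t)
  have hrsurj : ∀ (i : Fin (k + 1)) (x : Fin n), x ∈ twoIntervals n i.val (m + 1 + i - (k + 1)) m → ∃ t, r i t = x := by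
    intro i x hx
    have : x ∈ Set.range ((twoIntervals n i.val (m + 1 + i - (k + 1)) m).orderEmbOfFin (hR i)) := by
      rw [Finset.range_orderEmbOfFin]
      exact hx
    exact this
  have hcons : ∀ (i : Fin (k + 1)) (x : Fin n), x ∉ twoIntervals n i.val (m + 1 + i - (k + 1)) m →
      Function.Injective (Fin.cons x (r i) : Fin (k + 1) → Fin n) := by
    intro i x hx
    rw [Fin.cons_injective_iff]
    refine ⟨?_, (Finset.orderEmbOfFin _ (hR i)).injective⟩
    rintro ⟨t, rfl⟩
    exact hx (hr i t)
  let col : Fin (k + 1) → Fin n := fun j => ⟨j.val, by omega⟩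
  let ℓ : Fin (k + 1) → (Fin (k + 1) → ℝ) → ℝ :=
    fun i w => Matrix.cramer (C.submatrix id (Fin.cons d (r i) : Fin (k + 1) → Fin n)) w 0
  have hℓ : ∀ i x, ℓ i (C.col x) = colDet C (Fin.cons x (r i) : Fin (k + 1) → Fin n) :=
    fun i x => by
      simp only [ℓ]
      rw [cramer_submatrix, Fin.update_cons_zero]
  have hℓw : ∀ i w, colDet (C.updateCol d w) (Fin.cons d (r i) : Fin (k + 1) → Fin n) = ℓ i w := by
    intro i w
    simp only [ℓ]
    rw [Matrix.cramer_apply, colDet]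
    congr 1
    ext p t
    refine Fin.cases ?_ (fun t => ?_) t
    · simp
    · have : r i t ≠ d := fun h => by
        have h1 := hrm i t
        have h2 : (r i t).val = m := congrArg Fin.val h
        omega
      simp [this]
  have hdi : ∀ i : Fin (k + 1), d ∉ twoIntervals n i.val (m + 1 + i - (k + 1)) m := fun i => by
    rw [mem_twoIntervals]
    simp only [hd]
    omega
  let v : Fin (k + 1) → ℝ := fun i => vdm (Fin.cons d (r i) : Fin (k + 1) → Fin n)
  have hv : ∀ i, v i ≠ 0 := fun i => vdm_ne_zero (hcons i d (hdi i))
  have hpl : ∀ i : Fin (k + 1), ∀ w,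
      pl (C.updateCol d w) (twoIntervals n i.val (m + 1 + i - (k + 1)) (m + 1)) * |v i| =
        ℓ i w * v i := by
    intro i w
    rw [← hℓw]
    refine pl_mul_abs_vdm _ (hcons i d (hdi i)) ?_ fun t => ?_
    · rw [card_twoIntervals (by omega) (by omega) hm]
      omega
    · refine Fin.cases ?_ (fun t => ?_) t
      · simp [mem_twoIntervals, hd]
        omega
      · have := hrm i t
        rw [mem_twoIntervals, Fin.cons_succ]
        omega
  let L : Matrix (Fin (k + 1)) (Fin (k + 1)) ℝ := Matrix.of fun i j => ℓ i (C.col (col j))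
  have hLtri : L.BlockTriangular id := by
    intro i j hij
    have hij : j < i := hij
    simp only [L, Matrix.of_apply]
    rw [hℓ]
    refine colDet_eq_zero C fun hinj => ?_
    obtain ⟨t, ht⟩ := hrsurj i (col j) (mem_twoIntervals.2 (Or.inl hij))
    exact Fin.succ_ne_zero t (hinj (by simp [ht]))
  have hLdet : L.det ≠ 0 := by
    rw [Matrix.det_of_isUpperTriangular hLtri]
    refine Finset.prod_ne_zero_iff.2 fun i _ => ?_
    simp only [L, Matrix.of_apply]
    rw [hℓ]
    have hi : col i ∉ twoIntervals n i.val (m + 1 + i - (k + 1)) m := by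
      rw [mem_twoIntervals]
      simp only [col]
      omega
    have hcard : (twoIntervals n (i.val + 1) (m + 1 + i - (k + 1)) m).card = k + 1 := by
      rw [card_twoIntervals (by omega) (by omega) hm.le]
      omega
    have h1 := pl_mul_abs_vdm C (hcons i _ hi) hcard fun t => by
      refine Fin.cases ?_ (fun t => ?_) t
      · simp [mem_twoIntervals, col]
      · have := hrm i t
        rw [mem_twoIntervals, Fin.cons_succ]
        omega
    have h2 := hC _ hcard fun x hx => by
      rw [mem_twoIntervals] at hx
      omega
    intro h0
    rw [h0, zero_mul] at h1
    exact mul_ne_zero h2 (abs_ne_zero.2 (vdm_ne_zero (hcons i _ hi))) h1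
  obtain ⟨x, hx⟩ := (Matrix.mulVec_surjective_iff_isUnit.2
    ((Matrix.isUnit_iff_isUnit_det L).2 (isUnit_iff_ne_zero.2 hLdet)))
    (fun i => y i * |v i| / v i)
  refine ⟨∑ j, x j • C.col (col j), fun i hi => ?_⟩
  have h1 := hpl ⟨i, hi⟩ (∑ j, x j • C.col (col j))
  have h2 : ℓ ⟨i, hi⟩ (∑ j, x j • C.col (col j)) = L.mulVec x ⟨i, hi⟩ := by
    simp only [ℓ, map_sum, map_smul, Finset.sum_apply, Pi.smul_apply, smul_eq_mul,
      Matrix.mulVec, dotProduct, L, Matrix.of_apply]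
    exact Finset.sum_congr rfl fun _ _ => mul_comm _ _
  rw [h2, hx, div_mul_cancel₀ _ (hv _)] at h1
  exact mul_right_cancel₀ (abs_ne_zero.2 (hv _)) h1

/-- A positive tropical Plücker vector is the tropicalization of a family of totally positive
matrices. -/
theorem IsPosTrop.exists_lift (hP : IsPosTrop k P) (hk : 0 < k) (hkn : k ≤ n) :
    ∃ C : ℝ → Matrix (Fin k) (Fin n) ℝ, LiftsBelow P C n := by
  suffices H : ∀ m, k ≤ m → m ≤ n → ∃ C : ℝ → Matrix (Fin k) (Fin n) ℝ, LiftsBelow P C m from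
    H n hkn le_rfl
  intro m hkm
  induction m, hkm using Nat.le_induction with
  | base =>
    intro _
    set I₀ := twoIntervals n 0 0 k
    let δ : ℝ → Fin k → ℝ := fun s i => if i = ⟨0, hk⟩ then Real.exp (-(P I₀ * s)) else 1
    refine ⟨fun s => Matrix.of fun i j => if j.val = i.val then δ s i else 0, fun I hI hIk => ?_⟩
    have hI₀ : I₀.card = k := by
      rw [card_twoIntervals le_rfl (Nat.zero_le k) hkn]
      omega
    have hII : I = I₀ := Finset.eq_of_subset_of_card_le
      (fun x hx => mem_twoIntervals.2 (Or.inr ⟨Nat.zero_le _, hIk x hx⟩)) (by rw [hI, hI₀])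
    subst hII
    convert HasLead.exp (P I₀) using 2 with s
    rw [pl_eq_colDet _ (Fin.strictMono_castLE hkn) hI₀
      (fun i => mem_twoIntervals.2 (Or.inr ⟨Nat.zero_le _, i.isLt⟩)), colDet]
    have : (Matrix.of fun i (j : Fin n) => if j.val = i.val then δ s i else 0).submatrix id
        (Fin.castLE hkn) = Matrix.diagonal (δ s) := by
      ext i j
      simp [Matrix.diagonal_apply, Fin.ext_iff, eq_comm]
    rw [this, Matrix.det_diagonal]
    simp [δ]
  | succ m hkm ih =>
    intro hm
    obtain ⟨C, hC⟩ := ih (by omega)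
    choose w hw using fun s => exists_column (C s) hkm hm (fun I hI hIm => ((hC I hI hIm).1 s).ne')
      (fun i => Real.exp (-(P (twoIntervals n i (m + 1 + i - k) (m + 1)) * s)))
    refine ⟨fun s => (C s).updateCol ⟨m, hm⟩ (w s), hP.liftsBelow_succ hkm hm ?_ ?_⟩
    · intro I hI hIm
      have : (⟨m, hm⟩ : Fin n) ∉ I := fun h => (hIm _ h).false
      simpa only [pl_updateCol_of_notMem _ _ this] using hC I hI hIm
    · intro i hi
      simpa only [hw _ i hi] using HasLead.exp _

/-- The minimizing sets of a positive tropical Plücker vector form a positroid. -/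
theorem IsPosTrop.exists_matrix (hP : IsPosTrop k P) (hk : 0 < k) (hkn : k ≤ n) :
    ∃ C : Matrix (Fin k) (Fin n) ℝ, LinearIndependent ℝ (fun i => C i) ∧
      (∀ S : Finset (Fin n), S.card = k → 0 ≤ pl C S) ∧
      ∀ S : Finset (Fin n), S.card = k →
        (0 < pl C S ↔ ∀ T : Finset (Fin n), T.card = k → P S ≤ P T) := by
  obtain ⟨A, hA⟩ := hP.exists_lift hk hkn
  replace hA : ∀ I : Finset (Fin n), I.card = k → HasLead (fun s => pl (A s) I) (P I) :=
    fun I hI => hA I hI fun x _ => x.isLt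
  obtain ⟨I₀, hI₀, hmin⟩ := ((Finset.univ : Finset (Finset (Fin n))).filter
    fun S => S.card = k).exists_min_image P ⟨twoIntervals n 0 0 k, by
      simp [card_twoIntervals le_rfl (Nat.zero_le k) hkn]⟩
  simp only [Finset.mem_filter, Finset.mem_univ, true_and] at hI₀ hmin
  set e : Fin k → Fin n := fun t => ((I₀.orderIsoOfFin hI₀) t).val
  have he : Function.Injective e := Subtype.val_injective.comp (I₀.orderIsoOfFin hI₀).injective
  have hdet : ∀ s, ((A s).submatrix id e).det = pl (A s) I₀ := fun s => (pl_eq_pluck _ hI₀).symm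
  -- ratios of Plücker coordinates converge
  have hratio : ∀ I : Finset (Fin n), I.card = k → ∃ c : ℝ, 0 ≤ c ∧ (0 < c ↔ P I = P I₀) ∧
      Tendsto (fun s => pl (A s) I / pl (A s) I₀) atTop (𝓝 c) := by
    intro I hI
    have h := (hA I hI).div (hA I₀ hI₀)
    rcases (hmin I hI).eq_or_lt with heq | hlt
    · rw [heq, sub_self] at h
      obtain ⟨-, c, hc, hlim⟩ := h
      exact ⟨c, hc.le, by simp [hc, heq], by simpa using hlim⟩
    · refine ⟨0, le_rfl, by simp [hlt.ne'], ?_⟩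
      simpa using h.tendsto_zero (sub_pos.2 hlt)
  let B : ℝ → Matrix (Fin k) (Fin n) ℝ := fun s => ((A s).submatrix id e)⁻¹ * A s
  have hBpl : ∀ s (I : Finset (Fin n)), I.card = k → pl (B s) I = pl (A s) I / pl (A s) I₀ := by
    intro s I hI
    rw [pl_eq_pluck _ hI, pl_eq_pluck (A s) hI, pluck, pluck,
      Matrix.submatrix_mul _ _ id id _ Function.bijective_id, Matrix.det_mul, Matrix.submatrix_id_id,
      Matrix.det_nonsing_inv, hdet, Ring.inverse_eq_inv', mul_comm, div_eq_mul_inv]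
  have hBentry : ∀ s i j, B s i j = colDet (A s) (Function.update e i j) / pl (A s) I₀ := by
    intro s i j
    rw [← cramer_submatrix, ← hdet, Matrix.cramer_eq_adjugate_mulVec]
    simp only [B, Matrix.inv_def, Ring.inverse_eq_inv', Matrix.smul_mul, Matrix.smul_apply,
      smul_eq_mul]
    rw [inv_mul_eq_div]
    rfl
  have hBlim : ∀ i j, ∃ c : ℝ, Tendsto (fun s => B s i j) atTop (𝓝 c) := by
    intro i j
    simp only [hBentry]
    set f := Function.update e i j
    by_cases hf : Function.Injective f
    · have hcard : (Finset.univ.map ⟨f, hf⟩).card = k := by simp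
      obtain ⟨c, -, -, hc⟩ := hratio _ hcard
      have hfe : ∀ s, colDet (A s) f = pl (A s) (Finset.univ.map ⟨f, hf⟩) * (|vdm f| / vdm f) := by
        intro s
        have h1 := pl_mul_abs_vdm (A s) hf hcard (by simp)
        have h2 := vdm_ne_zero hf
        rw [mul_div_assoc', h1, mul_div_cancel_right₀ _ h2]
      refine ⟨c * (|vdm f| / vdm f), (hc.mul_const _).congr fun s => ?_⟩
      rw [hfe]
      ring
    · exact ⟨0, by simp [colDet_eq_zero _ hf]⟩
  choose B₀ hB₀ using hBlim
  have hlim : ∀ I : Finset (Fin n), I.card = k →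
      Tendsto (fun s => pl (B s) I) atTop (𝓝 (pl (Matrix.of B₀) I)) := by
    intro I hI
    simp only [pl_eq_pluck _ hI, pluck]
    have hcont : Continuous fun M : Matrix (Fin k) (Fin n) ℝ =>
        (M.submatrix id (fun t => ((I.orderIsoOfFin hI) t).val)).det :=
      (continuous_id.matrix_submatrix _ _).matrix_det
    refine (hcont.tendsto (Matrix.of B₀)).comp ?_
    exact tendsto_pi_nhds.2 fun i => tendsto_pi_nhds.2 fun j => hB₀ i j
  have hpl : ∀ I : Finset (Fin n), I.card = k →
      0 ≤ pl (Matrix.of B₀) I ∧ (0 < pl (Matrix.of B₀) I ↔ P I = P I₀) := by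
    intro I hI
    obtain ⟨c, hc0, hc, hclim⟩ := hratio I hI
    have h1 := hlim I hI
    simp only [hBpl _ I hI] at h1
    rw [tendsto_nhds_unique h1 hclim]
    exact ⟨hc0, hc⟩
  refine ⟨Matrix.of B₀, ?_, fun S hS => (hpl S hS).1, fun S hS => ?_⟩
  · have h0 : pl (Matrix.of B₀) I₀ ≠ 0 := ((hpl I₀ hI₀).2.2 rfl).ne'
    rw [pl_eq_pluck _ hI₀, pluck] at h0
    have hli := Matrix.linearIndependent_rows_of_det_ne_zero h0
    exact LinearIndependent.of_comp (LinearMap.funLeft ℝ ℝ e) hli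
  · rw [(hpl S hS).2]
    exact ⟨fun h T hT => h ▸ hmin T hT, fun h => le_antisymm (h I₀ hI₀) (hmin S hS)⟩

end Construction

/-! ### Faces of the subdivision -/

section Faces

variable {k n : ℕ}

lemma pl_of_pluck_pos {C : Matrix (Fin k) (Fin n) ℝ} {S : Finset (Fin n)} :
    (∃ h : S.card = k, 0 < pluck C S h) ↔ S.card = k ∧ 0 < pl C S :=
  ⟨fun ⟨h, hp⟩ => ⟨h, by rwa [pl_eq_pluck C h]⟩, fun ⟨h, hp⟩ => ⟨h, by rwa [← pl_eq_pluck C h]⟩⟩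

lemma mem_of_eVec_mem_convexHull {M : Set (Finset (Fin n))} {S : Finset (Fin n)}
    (h : eVec S ∈ convexHull ℝ (eVec '' M)) : S ∈ M := by
  by_contra hS
  let L : (Fin n → ℝ) →ₗ[ℝ] ℝ :=
    ∑ i, (if i ∈ S then (1 : ℝ) else -1) • LinearMap.proj i
  have hL : ∀ T, L (eVec T) = (T ∩ S).card - (T \ S).card := by
    intro T
    have h1 : L (eVec T) = ∑ i ∈ T, (if i ∈ S then (1 : ℝ) else -1) := by
      simp only [L, LinearMap.sum_apply, LinearMap.smul_apply, LinearMap.proj_apply, eVec,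
        smul_eq_mul, mul_ite, mul_one, mul_zero]
      rw [← Finset.sum_filter, Finset.filter_mem_eq_inter, Finset.univ_inter]
    rw [h1, Finset.sum_ite, Finset.filter_mem_eq_inter, Finset.filter_notMem_eq_sdiff]
    simp [sub_eq_add_neg]
  have hsub : convexHull ℝ (eVec '' M) ⊆ {x | L x ≤ S.card - 1} := by
    refine convexHull_min ?_ (convex_halfSpace_le L.isLinear _)
    rintro _ ⟨T, hT, rfl⟩
    have hTS : T ≠ S := fun e => hS (e ▸ hT)
    rw [Set.mem_ofPred_eq, hL]
    have h1 : (T ∩ S).card ≤ S.card := Finset.card_le_card Finset.inter_subset_right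
    by_cases h2 : T ⊆ S
    · have h3 : T.card < S.card := Finset.card_lt_card (Finset.ssubset_iff_subset_ne.2 ⟨h2, hTS⟩)
      have h4 : (T ∩ S).card + 1 ≤ S.card := by
        rw [Finset.inter_eq_left.2 h2]
        exact h3
      have h4 : ((T ∩ S).card : ℝ) + 1 ≤ S.card := by exact_mod_cast h4
      have : (0 : ℝ) ≤ (T \ S).card := Nat.cast_nonneg _
      linarith
    · have h3 : 1 ≤ (T \ S).card := Finset.card_pos.2 (Finset.sdiff_nonempty.2 h2)
      have h3 : (1 : ℝ) ≤ (T \ S).card := by exact_mod_cast h3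
      have h1 : ((T ∩ S).card : ℝ) ≤ S.card := by exact_mod_cast h1
      linarith
  have h0 := hsub h
  rw [Set.mem_ofPred_eq, hL] at h0
  simp at h0
  linarith

lemma convexHull_eVec_injective {M N : Set (Finset (Fin n))}
    (h : convexHull ℝ (eVec '' M) = convexHull ℝ (eVec '' N)) : M = N := by
  ext S
  constructor <;> intro hS <;> refine mem_of_eVec_mem_convexHull ?_
  · rw [← h]
    exact subset_convexHull ℝ _ ⟨S, hS, rfl⟩
  · rw [h]
    exact subset_convexHull ℝ _ ⟨S, hS, rfl⟩

/-- `S` minimizes `P + l` over all `k`-element sets. -/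
def IsFaceVertex (k : ℕ) (P : Finset (Fin n) → ℝ) (l : Fin n → ℝ) (S : Finset (Fin n)) : Prop :=
  S.card = k ∧ ∀ T : Finset (Fin n), T.card = k → (∑ i ∈ S, l i) + P S ≤ (∑ i ∈ T, l i) + P T

/-- A linear functional whose face contains only sets between `S` and `S ∪ Q`, and for which
membership of such a set in the face is decided among such sets. -/
lemma exists_isFaceVertex_iff (P : Finset (Fin n) → ℝ) (μ : Fin n → ℝ) (S Q : Finset (Fin n)) :
    ∃ l : Fin n → ℝ, ∀ I : Finset (Fin n), I.card = k → S ⊆ I → I ⊆ S ∪ Q →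
      (IsFaceVertex k P l I ↔ ∀ T : Finset (Fin n), T.card = k → S ⊆ T → T ⊆ S ∪ Q →
        (∑ i ∈ I, μ i) + P I ≤ (∑ i ∈ T, μ i) + P T) := by
  set F : Finset (Fin n) → ℝ := fun T => (∑ i ∈ T, μ i) + P T with hF
  set K : ℝ := ∑ T, |F T|
  have hK : ∀ T, |F T| ≤ K := fun T =>
    Finset.single_le_sum (f := fun T => |F T|) (fun _ _ => abs_nonneg _) (Finset.mem_univ T)
  have hK0 : 0 ≤ K := (abs_nonneg _).trans (hK ∅)
  let ν : Fin n → ℝ := fun i => if i ∈ S then -(2 * K) else if i ∈ Q then 0 else 2 * K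
  have hν : ∀ T, ∑ i ∈ T, ν i = 2 * K * ((T \ (S ∪ Q)).card - (T ∩ S).card) := by
    intro T
    have h1 : ∀ i, ν i = (if i ∈ S then -(2 * K) else 0) + (if i ∉ S ∪ Q then 2 * K else 0) := by
      intro i
      by_cases hS : i ∈ S <;> by_cases hQ : i ∈ Q <;> simp [ν, hS, hQ]
    rw [Finset.sum_congr rfl fun i _ => h1 i, Finset.sum_add_distrib, ← Finset.sum_filter,
      ← Finset.sum_filter, Finset.filter_mem_eq_inter, Finset.filter_notMem_eq_sdiff]
    simp only [Finset.sum_const, nsmul_eq_mul]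
    ring
  have hin : ∀ T, S ⊆ T → T ⊆ S ∪ Q → ∑ i ∈ T, ν i = - (2 * K * S.card) := by
    intro T h1 h2
    rw [hν, Finset.sdiff_eq_empty_iff_subset.2 h2, Finset.inter_eq_right.2 h1]
    simp
  have hout : ∀ T, ¬ (S ⊆ T ∧ T ⊆ S ∪ Q) → 2 * K - 2 * K * S.card ≤ ∑ i ∈ T, ν i := by
    intro T hT
    rw [hν]
    have h1 : (T ∩ S).card ≤ S.card := Finset.card_le_card Finset.inter_subset_right
    have h2 : 1 + (T ∩ S).card ≤ (T \ (S ∪ Q)).card + S.card := by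
      by_cases h3 : T ⊆ S ∪ Q
      · have h4 : ¬ S ⊆ T := fun h => hT ⟨h, h3⟩
        have : (T ∩ S).card < S.card := Finset.card_lt_card
          (Finset.ssubset_iff_subset_ne.2 ⟨Finset.inter_subset_right,
            fun h => h4 (Finset.inter_eq_right.1 h)⟩)
        omega
      · have : 0 < (T \ (S ∪ Q)).card := Finset.card_pos.2 (Finset.sdiff_nonempty.2 h3)
        omega
    have h2 : (1 : ℝ) + (T ∩ S).card ≤ (T \ (S ∪ Q)).card + S.card := by exact_mod_cast h2
    nlinarith
  have hsum : ∀ T, (∑ i ∈ T, (ν i + μ i)) + P T = ∑ i ∈ T, ν i + F T := fun T => by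
    rw [Finset.sum_add_distrib, hF, add_assoc]
  refine ⟨fun i => ν i + μ i, fun I hI hSI hIQ => ?_⟩
  simp only [IsFaceVertex, hsum, hin I hSI hIQ]
  constructor
  · rintro ⟨-, h⟩ T hT hST hTQ
    have := h T hT
    rw [hin T hST hTQ] at this
    exact le_of_add_le_add_left this
  · refine fun h => ⟨hI, fun T hT => ?_⟩
    by_cases hTin : S ⊆ T ∧ T ⊆ S ∪ Q
    · rw [hin T hTin.1 hTin.2]
      exact add_le_add_right (h T hT hTin.1 hTin.2) _
    · have h1 := hout T hTin
      have h2 := abs_le.1 (hK T)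
      have h3 := abs_le.1 (hK I)
      linarith [h2.1, h3.2]

lemma subset_quad_cases {a b c d : Fin n} {S T : Finset (Fin n)} (hS : S.card + 2 = k)
    (hT : T.card = k) (hST : S ⊆ T) (hTQ : T ⊆ S ∪ {a, b, c, d}) :
    ∃ x y, (x, y) ∈ [(a, b), (a, c), (a, d), (b, c), (b, d), (c, d)] ∧
      T = insert x (insert y S) := by
  have hcard : (T \ S).card = 2 := by
    rw [Finset.card_sdiff_of_subset hST]
    omega
  obtain ⟨x, y, hxy, hTS⟩ := Finset.card_eq_two.1 hcard
  have hTeq : T = insert x (insert y S) := by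
    rw [← Finset.sdiff_union_of_subset hST, hTS]
    ext z
    simp
  have hx : x ∈ ({a, b, c, d} : Finset (Fin n)) := by
    have hx : x ∈ T \ S := by simp [hTS]
    rw [Finset.mem_sdiff] at hx
    exact (Finset.mem_union.1 (hTQ hx.1)).resolve_left hx.2
  have hy : y ∈ ({a, b, c, d} : Finset (Fin n)) := by
    have hy : y ∈ T \ S := by simp [hTS]
    rw [Finset.mem_sdiff] at hy
    exact (Finset.mem_union.1 (hTQ hy.1)).resolve_left hy.2
  simp only [Finset.mem_insert, Finset.mem_singleton] at hx hy
  rcases hx with rfl | rfl | rfl | rfl <;> rcases hy with rfl | rfl | rfl | rfl <;>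
    first
    | exact absurd rfl hxy
    | (refine ⟨_, _, ?_, hTeq⟩; simp; done)
    | (refine ⟨_, _, ?_, hTeq.trans (Finset.insert_comm _ _ _)⟩; simp)

/-- If all faces are supports of totally nonnegative matrices, the three-term relations hold. -/
lemma isPosTrop_of_faces {P : Finset (Fin n) → ℝ}
    (h : ∀ l : Fin n → ℝ, ∃ C : Matrix (Fin k) (Fin n) ℝ,
      (∀ S : Finset (Fin n), S.card = k → 0 ≤ pl C S) ∧
      ∀ S : Finset (Fin n), S.card = k → (IsFaceVertex k P l S ↔ 0 < pl C S)) :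
    IsPosTrop k P := by
  intro a b c d hab hbc hcd S hS ha hb hc hd
  have hac := hab.trans hbc
  have hbd := hbc.trans hcd
  have had := hac.trans hcd
  set pab := P (insert a (insert b S)) with hpab
  set pac := P (insert a (insert c S)) with hpac
  set pad := P (insert a (insert d S)) with hpad
  set pbc := P (insert b (insert c S)) with hpbc
  set pbd := P (insert b (insert d S)) with hpbd
  set pcd := P (insert c (insert d S)) with hpcd
  -- the functional `μ` equalizes the heights of opposite vertices of the octahedron
  let μ : Fin n → ℝ := fun i =>
    if i = b then -((pbd - pac + (pbc - pad)) / 2) else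
    if i = c then -((pcd - pab + (pbc - pad)) / 2) else
    if i = d then -((pbd - pac + (pcd - pab)) / 2) else 0
  have μa : μ a = 0 := by simp [μ, hab.ne, hac.ne, had.ne]
  have μb : μ b = -((pbd - pac + (pbc - pad)) / 2) := by simp [μ]
  have μc : μ c = -((pcd - pab + (pbc - pad)) / 2) := by simp [μ, hbc.ne']
  have μd : μ d = -((pbd - pac + (pcd - pab)) / 2) := by simp [μ, hbd.ne', hcd.ne']
  obtain ⟨l, hl⟩ := exists_isFaceVertex_iff (k := k) P μ S {a, b, c, d}
  obtain ⟨C, hC0, hC⟩ := h l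
  set s := ∑ i ∈ S, μ i with hs
  -- the face restricted to the octahedron
  have hface : ∀ x y, x ≠ y → x ∉ S → y ∉ S → x ∈ ({a, b, c, d} : Finset (Fin n)) →
      y ∈ ({a, b, c, d} : Finset (Fin n)) →
      (0 < pl C (insert x (insert y S)) ↔
        μ x + μ y + P (insert x (insert y S)) ≤ μ a + μ b + pab ∧
        μ x + μ y + P (insert x (insert y S)) ≤ μ a + μ c + pac ∧
        μ x + μ y + P (insert x (insert y S)) ≤ μ a + μ d + pad) := by
    intro x y hxy hx hy hxQ hyQ
    have hcard := card_insert_insert hS hxy hx hy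
    have hsub : ∀ z w : Fin n, S ⊆ insert z (insert w S) := fun z w =>
      (Finset.subset_insert _ _).trans (Finset.subset_insert _ _)
    have hsubQ : ∀ z w : Fin n, z ∈ ({a, b, c, d} : Finset (Fin n)) →
        w ∈ ({a, b, c, d} : Finset (Fin n)) → insert z (insert w S) ⊆ S ∪ {a, b, c, d} :=
      fun z w hz hw => Finset.insert_subset (Finset.mem_union_right _ hz)
        (Finset.insert_subset (Finset.mem_union_right _ hw) Finset.subset_union_left)
    rw [← hC _ hcard, hl _ hcard (hsub x y) (hsubQ x y hxQ hyQ), sum_insert_insert μ hxy hx hy]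
    constructor
    · intro H
      have h1 := H _ (card_insert_insert hS hab.ne ha hb) (hsub _ _)
        (hsubQ _ _ (by simp) (by simp))
      have h2 := H _ (card_insert_insert hS hac.ne ha hc) (hsub _ _)
        (hsubQ _ _ (by simp) (by simp))
      have h3 := H _ (card_insert_insert hS had.ne ha hd) (hsub _ _)
        (hsubQ _ _ (by simp) (by simp))
      rw [sum_insert_insert μ hab.ne ha hb] at h1
      rw [sum_insert_insert μ hac.ne ha hc] at h2
      rw [sum_insert_insert μ had.ne ha hd] at h3
      refine ⟨?_, ?_, ?_⟩ <;> linarith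
    · rintro ⟨h1, h2, h3⟩ T hT hST hTQ
      obtain ⟨z, w, hzw, rfl⟩ := subset_quad_cases hS hT hST hTQ
      simp only [List.mem_cons, Prod.mk.injEq, List.not_mem_nil, or_false] at hzw
      rcases hzw with ⟨rfl, rfl⟩ | ⟨rfl, rfl⟩ | ⟨rfl, rfl⟩ | ⟨rfl, rfl⟩ | ⟨rfl, rfl⟩ | ⟨rfl, rfl⟩
      · rw [sum_insert_insert μ hab.ne ha hb]; linarith
      · rw [sum_insert_insert μ hac.ne ha hc]; linarith
      · rw [sum_insert_insert μ had.ne ha hd]; linarith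
      · rw [sum_insert_insert μ hbc.ne hb hc]; linarith
      · rw [sum_insert_insert μ hbd.ne hb hd]; linarith
      · rw [sum_insert_insert μ hcd.ne hc hd]; linarith
  have fab := hface a b hab.ne ha hb (by simp) (by simp)
  have fac := hface a c hac.ne ha hc (by simp) (by simp)
  have fad := hface a d had.ne ha hd (by simp) (by simp)
  have fbc := hface b c hbc.ne hb hc (by simp) (by simp)
  have fbd := hface b d hbd.ne hb hd (by simp) (by simp)
  have fcd := hface c d hcd.ne hc hd (by simp) (by simp)
  have hrel := pl_three_term C hab hbc hcd hS ha hb hc hd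
  have nn : ∀ x y, x ≠ y → x ∉ S → y ∉ S → 0 ≤ pl C (insert x (insert y S)) :=
    fun x y hxy hx hy => hC0 _ (card_insert_insert hS hxy hx hy)
  have nab := nn a b hab.ne ha hb
  have nac := nn a c hac.ne ha hc
  have nad := nn a d had.ne ha hd
  have nbc := nn b c hbc.ne hb hc
  have nbd := nn b d hbd.ne hb hd
  have ncd := nn c d hcd.ne hc hd
  rw [← hpab, μa, μb, μc, μd] at fab
  rw [← hpac, μa, μb, μc, μd] at fac
  rw [← hpad, μa, μb, μc, μd] at fad
  rw [← hpbc, μa, μb, μc, μd] at fbc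
  rw [← hpbd, μa, μb, μc, μd] at fbd
  rw [← hpcd, μa, μb, μc, μd] at fcd
  by_cases hx : pac + pbd ≤ pab + pcd ∧ pac + pbd ≤ pad + pbc
  · have h1 := fac.2 ⟨by linarith, by linarith, by linarith⟩
    have h2 := fbd.2 ⟨by linarith, by linarith, by linarith⟩
    have h3 := mul_pos h1 h2
    rw [hrel] at h3
    by_cases h4 : 0 < pl C (insert a (insert b S))
    · have := fab.1 h4
      left; constructor <;> linarith
    · have h4 : pl C (insert a (insert b S)) = 0 := le_antisymm (not_lt.1 h4) nab
      rw [h4, zero_mul, zero_add] at h3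
      have := fad.1 (pos_of_mul_pos_left h3 nbc)
      right; constructor <;> linarith
  · exfalso
    rw [not_and_or, not_le, not_le] at hx
    have hac0 : pl C (insert a (insert c S)) = 0 := by
      refine le_antisymm (not_lt.1 fun h => ?_) nac
      have := fac.1 h
      rcases hx with hx | hx <;> linarith
    rw [hac0, zero_mul] at hrel
    rcases le_total (pab + pcd) (pad + pbc) with hy | hy
    · have hlt : pab + pcd < pac + pbd := by rcases hx with hx | hx <;> linarith
      have h1 := fab.2 ⟨by linarith, by linarith, by linarith⟩
      have h2 := fcd.2 ⟨by linarith, by linarith, by linarith⟩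
      have := mul_pos h1 h2
      have := mul_nonneg nad nbc
      linarith
    · have hlt : pad + pbc < pac + pbd := by rcases hx with hx | hx <;> linarith
      have h1 := fad.2 ⟨by linarith, by linarith, by linarith⟩
      have h2 := fbc.2 ⟨by linarith, by linarith, by linarith⟩
      have := mul_pos h1 h2
      have := mul_nonneg nab ncd
      linarith

end Faces

/-- A height vector on the vertices of the hypersimplex is a positive tropical
Pluecker vector if and only if every face of the induced regular subdivision
is a positroid polytope. -/
theorem stmt14 (k n : ℕ) (hk : 0 < k) (hkn : k < n)
    (P : Finset (Fin n) → ℝ) :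
    (∀ a b c d : Fin n, a < b → b < c → c < d →
      ∀ S : Finset (Fin n), S.card + 2 = k →
        a ∉ S → b ∉ S → c ∉ S → d ∉ S →
        ((P (insert a (insert c S)) + P (insert b (insert d S)) =
            P (insert a (insert b S)) + P (insert c (insert d S)) ∧
          P (insert a (insert b S)) + P (insert c (insert d S)) ≤
            P (insert a (insert d S)) + P (insert b (insert c S))) ∨
        (P (insert a (insert c S)) + P (insert b (insert d S)) =
            P (insert a (insert d S)) + P (insert b (insert c S)) ∧
          P (insert a (insert d S)) + P (insert b (insert c S)) ≤
            P (insert a (insert b S)) + P (insert c (insert d S))))) ↔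
    (∀ lam : Fin n → ℝ,
      ∃ C : Matrix (Fin k) (Fin n) ℝ,
        LinearIndependent ℝ (fun i => C i) ∧
        (∀ (S : Finset (Fin n)) (h : S.card = k), 0 ≤ pluck C S h) ∧
        convexHull ℝ {x : Fin n → ℝ | ∃ S : Finset (Fin n), S.card = k ∧
            (∀ T : Finset (Fin n), T.card = k →
              (∑ i ∈ S, lam i) + P S ≤ (∑ i ∈ T, lam i) + P T) ∧
            x = eVec S} =
          convexHull ℝ {x : Fin n → ℝ |
            ∃ (S : Finset (Fin n)) (h : S.card = k), 0 < pluck C S h ∧ x = eVec S}) := by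
  have hM : ∀ l : Fin n → ℝ, {x : Fin n → ℝ | ∃ S : Finset (Fin n), S.card = k ∧
      (∀ T : Finset (Fin n), T.card = k → (∑ i ∈ S, l i) + P S ≤ (∑ i ∈ T, l i) + P T) ∧
      x = eVec S} = eVec '' {S | IsFaceVertex k P l S} := by
    intro l
    ext x
    exact ⟨fun ⟨S, h1, h2, h3⟩ => ⟨S, ⟨h1, h2⟩, h3.symm⟩, fun ⟨S, ⟨h1, h2⟩, h3⟩ =>
      ⟨S, h1, h2, h3.symm⟩⟩
  have hN : ∀ C : Matrix (Fin k) (Fin n) ℝ, {x : Fin n → ℝ |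
      ∃ (S : Finset (Fin n)) (h : S.card = k), 0 < pluck C S h ∧ x = eVec S} =
      eVec '' {S | S.card = k ∧ 0 < pl C S} := by
    intro C
    ext x
    constructor
    · rintro ⟨S, h, hp, rfl⟩
      exact ⟨S, pl_of_pluck_pos.1 ⟨h, hp⟩, rfl⟩
    · rintro ⟨S, hS, rfl⟩
      obtain ⟨h, hp⟩ := pl_of_pluck_pos.2 hS
      exact ⟨S, h, hp, rfl⟩
  simp only [hM, hN]
  constructor
  · intro hP l
    have hP : IsPosTrop k P := hP
    obtain ⟨C, hli, hC0, hC⟩ := (hP.add_linear l).exists_matrix hk hkn.le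
    refine ⟨C, hli, fun S h => pl_eq_pluck C h ▸ hC0 S h, congrArg _ (congrArg _ ?_)⟩
    ext S
    exact and_congr_right fun hS => (hC S hS).symm
  · intro h
    refine isPosTrop_of_faces fun l => ?_
    obtain ⟨C, -, hC0, hC⟩ := h l
    have hset := convexHull_eVec_injective hC
    refine ⟨C, fun S hS => pl_eq_pluck C hS ▸ hC0 S hS, fun S hS => ?_⟩
    have hiff : IsFaceVertex k P l S ↔ S.card = k ∧ 0 < pl C S := Set.ext_iff.1 hset S
    rw [hiff, and_iff_right hS]
end
end

section
/- Fix 0 < k ≤ n. Let χ : [n]^k → {−1, 0, 1} be a chirotope: χ is not identically zero; χ is alternating (swapping two arguments negates the value, and χ vanishes on tuples with repeated entries); and χ satisfies the Grassmann–Plücker exchange axiom: for all x_1,…,x_k, y_1,…,y_k ∈ [n], if χ(y_j, x_2,…,x_k)·χ(y_1,…,y_{j−1}, x_1, y_{j+1},…,y_k) ≥ 0 for all j ∈ [k], then χ(x_1,…,x_k)·χ(y_1,…,y_k) ≥ 0. Suppose χ is positively oriented: χ(i_1,…,i_k) ∈ {0, 1} whenever i_1 < i_2 < ⋯ < i_k.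 Then χ is realizable: there exists a real k×n matrix A such that for all (i_1,…,i_k) ∈ [n]^k, the sign of the determinant of the k×k matrix whose columns are columns i_1,…,i_k of A (in that order) equals χ(i_1,…,i_k). In particular, every positively oriented matroid is a positroid. -/
noncomputable section

open Function

/-- The sign of the permutation sorting a tuple, and `0` for tuples with a repeated entry. -/
def orderSign {k n : ℕ} (x : Fin k → Fin n) : ℤ :=
  Int.sign (Matrix.vandermonde fun i => ((x i : ℕ) : ℤ)).det

lemma orderSign_congr {k n m : ℕ} {x : Fin k → Fin n} {y : Fin k → Fin m}
    (h : ∀ i j, x i < x j ↔ y i < y j) : orderSign x = orderSign y := by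
  unfold orderSign
  rw [Matrix.det_vandermonde, Matrix.det_vandermonde, Int.sign_eq_sign, Int.sign_eq_sign]
  congr 1
  change signHom (∏ i, _) = signHom (∏ i, _)
  simp only [map_prod]
  refine Finset.prod_congr rfl fun i _ => Finset.prod_congr rfl fun j _ => ?_
  change SignType.sign _ = SignType.sign _
  have h1 := h i j
  have h2 := h j i
  simp only [Fin.lt_def] at h1 h2
  rcases lt_trichotomy (x i : ℕ) (x j) with h | h | h
  · rw [sign_pos (by omega), sign_pos (by omega)]
  · rw [show ((x j : ℕ) : ℤ) - (x i : ℕ) = 0 by omega,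
      show ((y j : ℕ) : ℤ) - (y i : ℕ) = 0 by omega]
  · rw [sign_neg (by omega), sign_neg (by omega)]

lemma orderSign_ne_zero {k n : ℕ} {x : Fin k → Fin n} :
    orderSign x ≠ 0 ↔ Injective x := by
  unfold orderSign
  rw [Ne, Int.sign_eq_zero_iff_zero, ← Ne, Matrix.det_vandermonde_ne_zero_iff]
  have : Injective fun m : Fin n => ((m : ℕ) : ℤ) := fun a b h => by
    simpa [Fin.ext_iff] using h
  exact this.of_comp_iff x

lemma orderSign_mul_self {k n : ℕ} {x : Fin k → Fin n} (h : Injective x) :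
    orderSign x * orderSign x = 1 := by
  have h0 := orderSign_ne_zero.2 h
  have : orderSign x = 1 ∨ orderSign x = -1 := by
    unfold orderSign at h0 ⊢
    rcases lt_trichotomy (Matrix.vandermonde fun i => ((x i : ℕ) : ℤ)).det 0 with h | h | h
    · exact Or.inr (Int.sign_eq_neg_one_of_neg h)
    · simp [h] at h0
    · exact Or.inl (Int.sign_eq_one_of_pos h)
  rcases this with h | h <;> simp [h]

lemma orderSign_of_strictMono {k n : ℕ} {x : Fin k → Fin n} (h : StrictMono x) :
    orderSign x = 1 := by
  unfold orderSign
  rw [Matrix.det_vandermonde]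
  refine Int.sign_eq_one_of_pos (Finset.prod_pos fun i _ => Finset.prod_pos fun j hj => ?_)
  have := h (Finset.mem_Ioi.1 hj)
  simp only [Fin.lt_def] at this
  omega

lemma orderSign_comp_perm {k n : ℕ} (x : Fin k → Fin n) (σ : Equiv.Perm (Fin k)) :
    orderSign (x ∘ σ) = Equiv.Perm.sign σ * orderSign x := by
  unfold orderSign
  have : (Matrix.vandermonde fun i => (((x ∘ σ) i : ℕ) : ℤ))
      = (Matrix.vandermonde fun i => ((x i : ℕ) : ℤ)).submatrix σ id := by
    ext i j; simp [Matrix.vandermonde_apply]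
  rw [this, Matrix.det_permute, Int.sign_mul]
  rcases Int.units_eq_one_or (Equiv.Perm.sign σ) with h | h <;> simp [h]

lemma orderSign_comp_swap {k n : ℕ} (x : Fin k → Fin n) {i j : Fin k} (h : i ≠ j) :
    orderSign (x ∘ Equiv.swap i j) = -orderSign x := by
  rw [orderSign_comp_perm, Equiv.Perm.sign_swap h]; simp

lemma exists_perm_strictMono {k n : ℕ} {x : Fin k → Fin n} (h : Injective x) :
    ∃ σ : Equiv.Perm (Fin k), StrictMono (x ∘ σ) :=
  ⟨Tuple.sort x, (Tuple.monotone_sort x).strictMono_of_injective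
    (h.comp (Tuple.sort x).injective)⟩

/-- The contribution of inserting `a` in front of the tuple `s` to the order sign. -/
def insertSign {k n : ℕ} (s : Fin k → Fin n) (a : Fin n) : ℤ :=
  Int.sign (∏ i, (((s i : ℕ) : ℤ) - (a : ℕ)))

lemma orderSign_cons {k n : ℕ} (a : Fin n) (s : Fin k → Fin n) :
    orderSign (Fin.cons a s : Fin (k + 1) → Fin n) = insertSign s a * orderSign s := by
  unfold orderSign insertSign
  rw [← Int.sign_mul, Matrix.det_vandermonde, Matrix.det_vandermonde, Fin.prod_univ_succ]
  simp [Fin.prod_Ioi_succ]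

lemma insertSign_cons {k n : ℕ} (a b : Fin n) (s : Fin k → Fin n) :
    insertSign (Fin.cons b s : Fin (k + 1) → Fin n) a
      = Int.sign (((b : ℕ) : ℤ) - (a : ℕ)) * insertSign s a := by
  unfold insertSign
  rw [← Int.sign_mul, Fin.prod_univ_succ]
  simp

lemma orderSign_cons_cons_of_lt {k n : ℕ} {a b : Fin n} (h : a < b) (s : Fin k → Fin n) :
    orderSign (Fin.cons a (Fin.cons b s) : Fin (k + 2) → Fin n)
      = insertSign s a * insertSign s b * orderSign s := by
  have : Int.sign (((b : ℕ) : ℤ) - (a : ℕ)) = 1 :=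
    Int.sign_eq_one_of_pos (by rw [Fin.lt_def] at h; omega)
  rw [orderSign_cons, orderSign_cons, insertSign_cons, this]
  ring

lemma orderSign_cons_cons_comm {k n : ℕ} (a b : Fin n) (s : Fin k → Fin n) :
    orderSign (Fin.cons a (Fin.cons b s) : Fin (k + 2) → Fin n)
      = -orderSign (Fin.cons b (Fin.cons a s) : Fin (k + 2) → Fin n) := by
  have : ((b : ℕ) : ℤ) - (a : ℕ) = - (((a : ℕ) : ℤ) - (b : ℕ)) := by ring
  simp only [orderSign_cons, insertSign_cons]
  rw [this, Int.sign_neg]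
  ring

/-- A valuated matroid on tuples, with bases oriented by `orderSign`, all of whose exchange
relations respect the orientation. -/
structure IsPositiveValuation {r n : ℕ} (w : (Fin (r + 1) → Fin n) → ℕ∞) : Prop where
  comp_perm : ∀ x (σ : Equiv.Perm (Fin (r + 1))), w (x ∘ σ) = w x
  eq_top : ∀ x, ¬ Injective x → w x = ⊤
  exchange : ∀ x y, w x ≠ ⊤ → w y ≠ ⊤ → ∃ l,
    w (update x 0 (y l)) + w (update y l (x 0)) ≤ w x + w y ∧
    orderSign (update x 0 (y l)) * orderSign (update y l (x 0)) = orderSign x * orderSign y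

lemma IsPositiveValuation.injective {r n : ℕ} {w : (Fin (r + 1) → Fin n) → ℕ∞}
    (hw : IsPositiveValuation w) {x : Fin (r + 1) → Fin n} (h : w x ≠ ⊤) : Injective x := by
  by_contra h'
  exact h (hw.eq_top x h')

/-- The tropical analogue of adding an infinitesimal multiple of column `p` to column `q`. -/
def perturbation {r n : ℕ} (w : (Fin (r + 1) → Fin n) → ℕ∞) (p q : Fin n)
    (x : Fin (r + 1) → Fin n) : ℕ∞ :=
  min (w x) (1 + w (update id q p ∘ x))

lemma orderSign_collapse {k n : ℕ} {p q : Fin n}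
    (hadj : ∀ z, z ≠ p → z ≠ q → (z < p ↔ z < q)) {x : Fin k → Fin n}
    (hx : Injective (update id q p ∘ x)) : orderSign (update id q p ∘ x) = orderSign x := by
  refine orderSign_congr fun i j => ?_
  by_cases hij : i = j
  · simp [hij]
  have hne := hx.ne hij
  by_cases hi : x i = q <;> by_cases hj : x j = q
  · exact absurd (by simp [hi, hj]) hne
  · simp only [comp_apply, hi, update_self, update_of_ne hj, id] at hne ⊢
    have := hadj (x j) hne.symm hj
    rw [Fin.lt_def, Fin.lt_def] at this ⊢
    simp only [Fin.lt_def, ne_eq, Fin.ext_iff] at *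
    omega
  · simp only [comp_apply, hj, update_self, update_of_ne hi, id] at hne ⊢
    exact hadj (x i) hne hi
  · simp [update_of_ne hi, update_of_ne hj]

lemma collapse_comp_of_notMem {k n : ℕ} {p q : Fin n} {x : Fin k → Fin n}
    (hx : ∀ i, x i ≠ q) : update id q p ∘ x = x := by
  funext i
  simp [update_of_ne (hx i)]

lemma update_update_eq_comp_swap {k n : ℕ} (y : Fin k → Fin n) {i j : Fin k} (hij : i ≠ j)
    (a b : Fin n) :
    update (update y i a) j b = (update (update y j a) i b) ∘ Equiv.swap i j := by
  funext m
  rcases eq_or_ne m i with rfl | hi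
  · simp [hij, hij.symm]
  rcases eq_or_ne m j with rfl | hj
  · simp
  · simp [Equiv.swap_apply_of_ne_of_ne hi hj, hi, hj]

namespace IsPositiveValuation

variable {r n : ℕ} {w : (Fin (r + 1) → Fin n) → ℕ∞}

lemma perturb_comp_perm (hw : IsPositiveValuation w) (p q : Fin n) (x : Fin (r + 1) → Fin n)
    (σ : Equiv.Perm (Fin (r + 1))) : perturbation w p q (x ∘ σ) = perturbation w p q x := by
  unfold perturbation
  rw [hw.comp_perm, ← comp_assoc, hw.comp_perm]

lemma perturb_eq_top (hw : IsPositiveValuation w) (p q : Fin n) (x : Fin (r + 1) → Fin n)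
    (hx : ¬ Injective x) : perturbation w p q x = ⊤ := by
  unfold perturbation
  rw [hw.eq_top x hx, hw.eq_top _ fun h => hx h.of_comp]
  simp

lemma perturb_cases (p q : Fin n) {x : Fin (r + 1) → Fin n} (hx : perturbation w p q x ≠ ⊤) :
    (w x ≠ ⊤ ∧ perturbation w p q x = w x) ∨
    (w (update id q p ∘ x) ≠ ⊤ ∧ perturbation w p q x = 1 + w (update id q p ∘ x) ∧
      ∃ m, x m = q) := by
  by_cases h : ∃ m, x m = q
  · rcases min_choice (w x) (1 + w (update id q p ∘ x)) with h' | h'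
    · left; exact ⟨by rwa [perturbation, h'] at hx, h'⟩
    · right; refine ⟨fun h0 => hx ?_, h', h⟩
      rw [perturbation, h', h0]; simp
  · left
    have : perturbation w p q x = w x := by
      rw [perturbation, collapse_comp_of_notMem (by simpa using h)]
      exact min_eq_left le_add_self
    exact ⟨this ▸ hx, this⟩

lemma perturb_exchange (hw : IsPositiveValuation w) {p q : Fin n}
    (hadj : ∀ z, z ≠ p → z ≠ q → (z < p ↔ z < q)) (x y : Fin (r + 1) → Fin n)
    (hx : perturbation w p q x ≠ ⊤) (hy : perturbation w p q y ≠ ⊤) : ∃ l,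
    perturbation w p q (update x 0 (y l)) + perturbation w p q (update y l (x 0))
      ≤ perturbation w p q x + perturbation w p q y ∧
    orderSign (update x 0 (y l)) * orderSign (update y l (x 0))
      = orderSign x * orderSign y := by
  have hxi : Injective x := by by_contra h; exact hx (hw.perturb_eq_top p q x h)
  have hyi : Injective y := by by_contra h; exact hy (hw.perturb_eq_top p q y h)
  by_cases hx0 : ∃ l, y l = x 0
  · obtain ⟨l, hl⟩ := hx0
    exact ⟨l, by rw [hl, update_eq_self, ← hl, update_eq_self], by
      rw [hl, update_eq_self, ← hl, update_eq_self]⟩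
  push Not at hx0
  have le1 : ∀ z, perturbation w p q z ≤ w z := fun z => min_le_left _ _
  have le2 : ∀ z, perturbation w p q z ≤ 1 + w (update id q p ∘ z) := fun z => min_le_right _ _
  have le3 : ∀ z : Fin (r + 1) → Fin n, (∀ i, z i ≠ q) →
      perturbation w p q z ≤ w (update id q p ∘ z) := fun z hz => by
    rw [collapse_comp_of_notMem hz]; exact le1 z
  have fin2 : ∀ {a b c d : ℕ∞}, a + b ≤ c + d → c ≠ ⊤ → d ≠ ⊤ → a ≠ ⊤ ∧ b ≠ ⊤ := by
    intro a b c d h hc hd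
    have := ne_top_of_le_ne_top (WithTop.add_ne_top.2 ⟨hc, hd⟩) h
    exact WithTop.add_ne_top.1 this
  have sg : ∀ {z : Fin (r + 1) → Fin n}, w (update id q p ∘ z) ≠ ⊤ →
      orderSign (update id q p ∘ z) = orderSign z := fun hz =>
    orderSign_collapse hadj (hw.injective hz)
  have sq : (update id q p : Fin n → Fin n) q = p := by simp
  have sne : ∀ {z}, z ≠ q → (update id q p : Fin n → Fin n) z = z := fun hz => by simp [hz]
  rcases perturb_cases p q hx with ⟨hwx, ex⟩ | ⟨hwx, ex, m, hm⟩ <;>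
  rcases perturb_cases p q hy with ⟨hwy, ey⟩ | ⟨hwy, ey, l₀, hl₀⟩
  · obtain ⟨l, h1, h2⟩ := hw.exchange x y hwx hwy
    refine ⟨l, ?_, h2⟩
    rw [ex, ey]
    exact (add_le_add (le1 _) (le1 _)).trans h1
  · have hx0q : x 0 ≠ q := fun h => hx0 l₀ (hl₀.trans h.symm)
    by_cases hqx : ∃ m, x m = q
    · obtain ⟨m, hm⟩ := hqx
      have hm0 : m ≠ 0 := fun h => hx0q (h ▸ hm)
      obtain ⟨l, h1, h2⟩ := hw.exchange x _ hwx hwy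
      obtain ⟨f1, f2⟩ := fin2 h1 hwx hwy
      by_cases hl : l = l₀
      · subst hl
        have e2 : update (update id q p ∘ y) l (x 0) = update y l (x 0) := by
          funext i
          rcases eq_or_ne i l with rfl | hi
          · simp
          · have : y i ≠ q := fun h => hi (hyi (h.trans hl₀.symm))
            simp [hi, this]
        have e1 : update x 0 ((update id q p ∘ y) l)
            = update (update id q p ∘ x) 0 q ∘ Equiv.swap 0 m := by
          rw [comp_apply, hl₀, sq]
          funext i
          rcases eq_or_ne i 0 with rfl | hi
          · simp [hm0, hm]
          rcases eq_or_ne i m with rfl | hi'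
          · simp [hi, hm]
          · have : x i ≠ q := fun h => hi' (hxi (h.trans hm.symm))
            simp [Equiv.swap_apply_of_ne_of_ne hi hi', hi, this]
        rw [e1, e2, hw.comp_perm] at h1
        rw [e1, hw.comp_perm] at f1
        rw [e1, e2, orderSign_comp_swap _ hm0.symm] at h2
        rw [e2] at f2
        obtain ⟨l', h3, h4⟩ := hw.exchange _ _ f1 f2
        rw [update_idem, update_self] at h3 h4
        obtain ⟨f3, f4⟩ := fin2 h3 f1 f2
        by_cases hl' : l' = l
        · subst hl'
          have e3 : update (update id q p ∘ x) 0 (x 0) = update id q p ∘ x := by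
            funext i
            rcases eq_or_ne i 0 with rfl | hi
            · simp [hx0q]
            · simp [hi]
          have e5 : update y l' q = y := by rw [← hl₀, update_eq_self]
          rw [update_self, update_idem, e3, e5] at h4
          rw [update_self, e3] at f3
          rw [sg f3] at h4
          rw [sg hwy] at h2
          have := mul_ne_zero (orderSign_ne_zero.2 hxi) (orderSign_ne_zero.2 hyi)
          exfalso; apply this; linarith
        · have e3 : update (update y l (x 0)) l' q
              = update y l' (x 0) ∘ Equiv.swap l l' := by
            rw [update_update_eq_comp_swap _ (Ne.symm hl')]
            congr 1
            rw [update_comm hl', ← hl₀, update_eq_self]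
          have hyl' : y l' ≠ q := fun h => hl' (hyi (h.trans hl₀.symm))
          have e4 : update (update id q p ∘ x) 0 (update y l (x 0) l')
              = update id q p ∘ update x 0 (y l') := by
            rw [update_of_ne hl', comp_update, sne hyl']
          rw [e4] at f3
          rw [e3, e4, hw.comp_perm] at h3
          rw [e3, e4, orderSign_comp_swap _ (Ne.symm hl'), sg f3] at h4
          refine ⟨l', ?_, ?_⟩
          · rw [ex, ey]
            calc _ ≤ 1 + w (update id q p ∘ update x 0 (y l')) + w (update y l' (x 0)) :=
                  add_le_add (le2 _) (le1 _)
              _ ≤ 1 + (w x + w (update id q p ∘ y)) := by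
                  rw [add_assoc]; exact add_le_add le_rfl (h3.trans h1)
              _ = _ := by ring
          · rw [sg hwy] at h2
            linarith
      · have hyl : y l ≠ q := fun h => hl (hyi (h.trans hl₀.symm))
        have e2 : update (update id q p ∘ y) l (x 0) = update id q p ∘ update y l (x 0) := by
          rw [comp_update, sne hx0q]
        rw [comp_apply, sne hyl] at h1 h2 f1
        rw [e2] at h1 h2 f2
        rw [sg f2, sg hwy] at h2
        refine ⟨l, ?_, h2⟩
        rw [ex, ey]
        calc _ ≤ w (update x 0 (y l)) + (1 + w (update id q p ∘ update y l (x 0))) :=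
              add_le_add (le1 _) (le2 _)
          _ = 1 + (w (update x 0 (y l)) + w (update id q p ∘ update y l (x 0))) := by ring
          _ ≤ 1 + (w x + w (update id q p ∘ y)) := by gcongr
          _ = _ := by ring
    · push Not at hqx
      have ex' := collapse_comp_of_notMem (p := p) hqx
      obtain ⟨l, h1, h2⟩ := hw.exchange (update id q p ∘ x) (update id q p ∘ y)
        (by rwa [ex']) hwy
      obtain ⟨f1, f2⟩ := fin2 h1 (by rwa [ex']) hwy
      simp only [comp_apply, ← comp_update] at h1 h2 f1 f2
      rw [sg f1, sg f2, ex', sg hwy] at h2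
      refine ⟨l, ?_, h2⟩
      rw [ex, ey]
      rw [ex'] at h1
      by_cases hl : l = l₀
      · have hz : ∀ i, update y l (x 0) i ≠ q := fun i => by
          rcases eq_or_ne i l with rfl | hi
          · simpa using hx0q
          · rw [update_of_ne hi]
            exact fun h => hi (hl ▸ hyi (h.trans hl₀.symm))
        calc _ ≤ _ := add_le_add (le2 _) (le3 _ hz)
          _ ≤ 1 + (w x + w (update id q p ∘ y)) := by rw [add_assoc]; gcongr
          _ = _ := by ring
      · have hz : ∀ i, update x 0 (y l) i ≠ q := fun i => by
          rcases eq_or_ne i 0 with rfl | hi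
          · rw [update_self]; exact fun h => hl (hyi (h.trans hl₀.symm))
          · rw [update_of_ne hi]; exact hqx i
        calc _ ≤ _ := add_le_add (le3 _ hz) (le2 _)
          _ = 1 + (w (update id q p ∘ update x 0 (y l))
                + w (update id q p ∘ update y l (x 0))) := by ring
          _ ≤ 1 + (w x + w (update id q p ∘ y)) := by gcongr
          _ = _ := by ring
  · by_cases hqy : ∃ l, y l = q
    · obtain ⟨l₀, hl₀⟩ := hqy
      have hx0q : x 0 ≠ q := fun h => hx0 l₀ (hl₀.trans h.symm)
      have hm0 : m ≠ 0 := fun h => hx0q (h ▸ hm)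
      obtain ⟨l, h1, h2⟩ := hw.exchange _ y hwx hwy
      obtain ⟨f1, f2⟩ := fin2 h1 hwx hwy
      rw [comp_apply, sne hx0q] at h1 h2 f2
      by_cases hl : l = l₀
      · subst hl
        have e1 : update (update id q p ∘ x) 0 (y l)
            = update x 0 p ∘ Equiv.swap 0 m := by
          rw [hl₀]
          funext i
          rcases eq_or_ne i 0 with rfl | hi
          · simp [hm0, hm]
          rcases eq_or_ne i m with rfl | hi'
          · simp [hi, hm]
          · have : x i ≠ q := fun h => hi' (hxi (h.trans hm.symm))
            simp [Equiv.swap_apply_of_ne_of_ne hi hi', hi, this]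
        rw [e1, hw.comp_perm] at h1 f1
        rw [e1, orderSign_comp_swap _ hm0.symm] at h2
        obtain ⟨l', h3, h4⟩ := hw.exchange _ _ f1 f2
        rw [update_idem, update_self] at h3 h4
        obtain ⟨f3, f4⟩ := fin2 h3 f1 f2
        by_cases hl' : l' = l
        · subst hl'
          have e3 : update y l' p = update id q p ∘ y := by
            funext i
            rcases eq_or_ne i l' with rfl | hi
            · simp [hl₀]
            · have : y i ≠ q := fun h => hi (hyi (h.trans hl₀.symm))
              simp [hi, this]
          rw [update_self, update_idem, update_eq_self, e3] at h4
          rw [update_idem, e3] at f4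
          rw [sg f4] at h4
          rw [sg hwx] at h2
          have := mul_ne_zero (orderSign_ne_zero.2 hxi) (orderSign_ne_zero.2 hyi)
          exfalso; apply this; linarith
        · have hyl' : y l' ≠ q := fun h => hl' (hyi (h.trans hl₀.symm))
          have e3 : update (update y l (x 0)) l' p
              = (update id q p ∘ update y l' (x 0)) ∘ Equiv.swap l l' := by
            rw [update_update_eq_comp_swap _ (Ne.symm hl')]
            congr 1
            funext i
            rcases eq_or_ne i l with rfl | hi
            · simp [Ne.symm hl', hl₀]
            rcases eq_or_ne i l' with rfl | hi'
            · simp [hi, hx0q]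
            · have : y i ≠ q := fun h => hi (hyi (h.trans hl₀.symm))
              simp [hi, hi', this]
          rw [update_of_ne hl'] at h3 h4
          rw [e3, hw.comp_perm] at h3 f4
          rw [e3, orderSign_comp_swap _ (Ne.symm hl'), sg f4] at h4
          refine ⟨l', ?_, ?_⟩
          · rw [ex, ey]
            calc _ ≤ w (update x 0 (y l')) + (1 + w (update id q p ∘ update y l' (x 0))) :=
                  add_le_add (le1 _) (le2 _)
              _ = 1 + (w (update x 0 (y l')) + w (update id q p ∘ update y l' (x 0))) := by
                  ring
              _ ≤ 1 + (w (update id q p ∘ x) + w y) := add_le_add le_rfl (h3.trans h1)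
              _ = _ := by ring
          · rw [sg hwx] at h2
            linarith
      · have hyl : y l ≠ q := fun h => hl (hyi (h.trans hl₀.symm))
        have e1 : update (update id q p ∘ x) 0 (y l) = update id q p ∘ update x 0 (y l) := by
          rw [comp_update, sne hyl]
        rw [e1] at h1 h2 f1
        rw [sg f1, sg hwx] at h2
        refine ⟨l, ?_, h2⟩
        rw [ex, ey]
        calc _ ≤ _ := add_le_add (le2 _) (le1 _)
          _ ≤ 1 + (w (update id q p ∘ x) + w y) := by rw [add_assoc]; gcongr
          _ = _ := by ring
    · push Not at hqy
      have ey' := collapse_comp_of_notMem (p := p) hqy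
      obtain ⟨l, h1, h2⟩ := hw.exchange (update id q p ∘ x) (update id q p ∘ y)
        hwx (by rwa [ey'])
      obtain ⟨f1, f2⟩ := fin2 h1 hwx (by rwa [ey'])
      simp only [comp_apply, ← comp_update] at h1 h2 f1 f2
      rw [sg f1, sg f2, ey', sg hwx] at h2
      refine ⟨l, ?_, h2⟩
      rw [ex, ey]
      rw [ey'] at h1
      by_cases hx0q : x 0 = q
      · have hz : ∀ i, update x 0 (y l) i ≠ q := fun i => by
          rcases eq_or_ne i 0 with rfl | hi
          · rw [update_self]; exact hqy l
          · rw [update_of_ne hi]; exact fun h => hi (hxi (h.trans hx0q.symm))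
        calc _ ≤ _ := add_le_add (le3 _ hz) (le2 _)
          _ = 1 + (w (update id q p ∘ update x 0 (y l))
                + w (update id q p ∘ update y l (x 0))) := by ring
          _ ≤ 1 + (w (update id q p ∘ x) + w y) := by gcongr
          _ = _ := by ring
      · have hz : ∀ i, update y l (x 0) i ≠ q := fun i => by
          rcases eq_or_ne i l with rfl | hi
          · simpa using hx0q
          · rw [update_of_ne hi]; exact hqy i
        calc _ ≤ _ := add_le_add (le2 _) (le3 _ hz)
          _ ≤ 1 + (w (update id q p ∘ x) + w y) := by rw [add_assoc]; gcongr
          _ = _ := by ring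
  · obtain ⟨l, h1, h2⟩ := hw.exchange _ _ hwx hwy
    obtain ⟨f1, f2⟩ := fin2 h1 hwx hwy
    simp only [comp_apply, ← comp_update] at h1 h2 f1 f2
    rw [sg f1, sg f2, sg hwx, sg hwy] at h2
    refine ⟨l, ?_, h2⟩
    rw [ex, ey]
    calc _ ≤ _ := add_le_add (le2 _) (le2 _)
      _ = 1 + 1 + (w (update id q p ∘ update x 0 (y l))
            + w (update id q p ∘ update y l (x 0))) := by ring
      _ ≤ 1 + 1 + (w (update id q p ∘ x) + w (update id q p ∘ y)) := by gcongr
      _ = _ := by ring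

lemma perturb (hw : IsPositiveValuation w) {p q : Fin n}
    (hadj : ∀ z, z ≠ p → z ≠ q → (z < p ↔ z < q)) : IsPositiveValuation (perturbation w p q) :=
  ⟨hw.perturb_comp_perm p q, hw.perturb_eq_top p q, hw.perturb_exchange hadj⟩

end IsPositiveValuation

lemma adjacent_iff_lt {n : ℕ} {p q : Fin n} (h : (p : ℕ) + 1 = q ∨ (q : ℕ) + 1 = p)
    (z : Fin n) (hp : z ≠ p) (hq : z ≠ q) : z < p ↔ z < q := by
  simp only [Fin.lt_def, ne_eq, Fin.ext_iff] at *
  omega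

/-- Injective tuples are connected under permutations and moving one entry to a free
neighbouring position. -/
lemma forall_injective_of_move {k n : ℕ} {P : (Fin k → Fin n) → Prop}
    (hperm : ∀ x (σ : Equiv.Perm (Fin k)), P (x ∘ σ) ↔ P x)
    (hmove : ∀ (p q : Fin n), ((p : ℕ) + 1 = q ∨ (q : ℕ) + 1 = p) → ∀ x, Injective x →
      Injective (update id q p ∘ x) → P (update id q p ∘ x) → P x)
    {x₀ : Fin k → Fin n} (hx₀ : Injective x₀) (h₀ : P x₀) (x : Fin k → Fin n)
    (hx : Injective x) : P x := by
  have hkn : k ≤ n := by simpa using Fintype.card_le_of_injective x₀ hx₀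
  suffices H : ∀ N, ∀ x : Fin k → Fin n, Injective x → ∑ i, (x i : ℕ) = N →
      (P x ↔ P (Fin.castLE hkn)) from (H _ x hx rfl).2 ((H _ x₀ hx₀ rfl).1 h₀)
  intro N
  induction N using Nat.strong_induction_on with
  | _ N ih =>
  intro x hx hN
  by_cases h : ∃ i, ∃ p : Fin n, (p : ℕ) + 1 = x i ∧ ∀ j, x j ≠ p
  · obtain ⟨i, p, hp, hfree⟩ := h
    have hy : update id (x i) p ∘ x = update x i p := by
      funext j
      rcases eq_or_ne j i with rfl | hj
      · simp
      · simp [hj, hx.ne hj]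
    have hyi : Injective (update x i p) := by
      intro a b hab
      by_cases ha : a = i <;> by_cases hb : b = i
      · rw [ha, hb]
      · simp only [ha, update_self, update_of_ne hb] at hab
        exact absurd hab.symm (hfree b)
      · simp only [hb, update_self, update_of_ne ha] at hab
        exact absurd hab (hfree a)
      · simp only [update_of_ne ha, update_of_ne hb] at hab
        exact hx hab
    have hback : update id p (x i) ∘ update x i p = x := by
      funext j
      rcases eq_or_ne j i with rfl | hj
      · simp
      · simp [hj, hfree j]
    have hlt : ∑ j, (update x i p j : ℕ) < N := by
      rw [← hN]
      refine Finset.sum_lt_sum (fun j _ => ?_) ⟨i, Finset.mem_univ i, by simp; omega⟩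
      rcases eq_or_ne j i with rfl | hj
      · simp; omega
      · simp [hj]
    rw [← ih _ hlt _ hyi rfl]
    constructor
    · intro hP
      exact hmove (x i) p (Or.inr hp) _ hyi (by rwa [hback]) (by rwa [hback])
    · intro hP
      exact hmove p (x i) (Or.inl hp) _ hx (by rwa [hy]) (by rwa [hy])
  · push Not at h
    obtain ⟨σ, hσ⟩ := exists_perm_strictMono hx
    rw [← hperm x σ]
    suffices x ∘ σ = Fin.castLE hkn by rw [this]
    have key : ∀ m, ∀ i : Fin k, (i : ℕ) = m → (x (σ i) : ℕ) = m := by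
      intro m
      induction m using Nat.strong_induction_on with
      | _ m ihm =>
      intro i hi
      rcases Nat.eq_zero_or_pos (x (σ i)) with h0 | hpos
      · by_contra hne
        have : (⟨0, by omega⟩ : Fin k) < i := Fin.lt_def.2 (by simp; omega)
        have := Fin.lt_def.1 (hσ this)
        simp only [comp_apply] at this
        omega
      · obtain ⟨j, hj⟩ := h (σ i) ⟨x (σ i) - 1, by omega⟩ (by simp; omega)
        obtain ⟨j, rfl⟩ := σ.surjective j
        have hj' : (x (σ j) : ℕ) + 1 = x (σ i) := by rw [hj]; simp; omega
        have hji : j < i := hσ.lt_iff_lt.1 (Fin.lt_def.2 (by simp only [comp_apply]; omega))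
        rw [Fin.lt_def] at hji
        have e1 := ihm j (by omega) j rfl
        by_contra hne
        have e2 := ihm (j + 1) (by omega) ⟨j + 1, by omega⟩ rfl
        have : x (σ ⟨j + 1, by omega⟩) = x (σ i) := Fin.ext (by omega)
        have := Fin.ext_iff.1 (σ.injective (hx this))
        simp at this
        omega
    funext i
    exact Fin.ext (key i i rfl)

/-- Perturbing repeatedly makes all tuples of distinct entries bases, without creating new
tuples of valuation zero. -/
lemma IsPositiveValuation.exists_finite {r n : ℕ} {w : (Fin (r + 1) → Fin n) → ℕ∞}
    (hw : IsPositiveValuation w) (hne : ∃ x, w x ≠ ⊤) :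
    ∃ w' : (Fin (r + 1) → Fin n) → ℕ∞, IsPositiveValuation w' ∧
      (∀ x, w' x = 0 ↔ w x = 0) ∧ ∀ x, Injective x → w' x ≠ ⊤ := by
  classical
  induction hN : (Finset.univ.filter fun x => Injective x ∧ w x = ⊤).card
    using Nat.strong_induction_on generalizing w with
  | _ N ih =>
  by_cases h : ∀ x, Injective x → w x ≠ ⊤
  · exact ⟨w, hw, fun _ => Iff.rfl, h⟩
  obtain ⟨x₀, hx₀⟩ := hne
  have : ∃ p q : Fin n, ((p : ℕ) + 1 = q ∨ (q : ℕ) + 1 = p) ∧ ∃ x, Injective x ∧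
      w (update id q p ∘ x) ≠ ⊤ ∧ w x = ⊤ := by
    by_contra hcon
    push Not at hcon
    refine h fun x hx => forall_injective_of_move (P := fun x => w x ≠ ⊤)
      (fun x σ => by rw [hw.comp_perm]) ?_ (hw.injective hx₀) hx₀ x hx
    intro p q hpq x hx _ hP
    exact hcon p q hpq x hx hP
  obtain ⟨p, q, hpq, x, hx, hx1, hx2⟩ := this
  have hlt : (Finset.univ.filter fun z => Injective z ∧ perturbation w p q z = ⊤).card < N := by
    rw [← hN]
    refine Finset.card_lt_card ⟨fun z hz => ?_, fun hsub => ?_⟩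
    · simp only [Finset.mem_filter, Finset.mem_univ, true_and] at hz ⊢
      exact ⟨hz.1, top_le_iff.1 (hz.2 ▸ min_le_left _ _)⟩
    · have := hsub (Finset.mem_filter.2 ⟨Finset.mem_univ x, hx, hx2⟩)
      simp only [Finset.mem_filter, Finset.mem_univ, true_and] at this
      have hle : perturbation w p q x ≤ 1 + w (update id q p ∘ x) := min_le_right _ _
      rw [this.2, top_le_iff] at hle
      exact WithTop.add_ne_top.2 ⟨ENat.natCast_ne_top 1, hx1⟩ hle
  obtain ⟨w', h1, h2, h3⟩ := ih _ hlt (hw.perturb (adjacent_iff_lt hpq))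
    ⟨x₀, ne_top_of_le_ne_top hx₀ (min_le_left _ _)⟩ rfl
  refine ⟨w', h1, fun z => ?_, h3⟩
  rw [h2]
  unfold perturbation
  simp only [min_eq_iff, add_eq_zero, one_ne_zero, false_and, or_false]
  exact ⟨fun h => h.1, fun h => ⟨h, by simp [h]⟩⟩

lemma exists_perm_comp_eq_cons_cons {k : ℕ} {α : Type*} (x : Fin (k + 2) → α)
    {i j : Fin (k + 2)} (hij : i ≠ j) : ∃ (σ : Equiv.Perm (Fin (k + 2))) (s : Fin k → α),
      x ∘ σ = Fin.cons (x i) (Fin.cons (x j) s) := by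
  have hj : Equiv.swap 0 i j ≠ 0 := fun h => hij (by
    rw [Equiv.swap_apply_eq_iff, Equiv.swap_apply_left] at h
    exact h.symm)
  let σ : Equiv.Perm (Fin (k + 2)) := Equiv.swap 0 i * Equiv.swap 1 (Equiv.swap 0 i j)
  have h0 : σ 0 = i := by
    simp [σ, Equiv.Perm.mul_apply, Equiv.swap_apply_of_ne_of_ne (zero_ne_one) hj.symm]
  have h1 : σ 1 = j := by
    simp [σ, Equiv.Perm.mul_apply]
  refine ⟨σ, fun l => x (σ l.succ.succ), ?_⟩
  funext l
  refine Fin.cases ?_ (fun l => ?_) l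
  · simp [h0]
  · refine Fin.cases ?_ (fun l => ?_) l
    · simp [h1]
    · simp

lemma update_cons_cons_zero {k : ℕ} {α : Type*} (a b c : α) (s : Fin k → α) :
    update (Fin.cons a (Fin.cons b s) : Fin (k + 2) → α) 0 c = Fin.cons c (Fin.cons b s) := by
  simp

lemma update_cons_cons_one {k : ℕ} {α : Type*} (a b c : α) (s : Fin k → α) :
    update (Fin.cons a (Fin.cons b s) : Fin (k + 2) → α) (Fin.succ 0) c
      = Fin.cons a (Fin.cons c s) := by
  rw [← Fin.cons_update]
  simp

lemma not_injective_cons_cons_apply {k : ℕ} {α : Type*} (b : α) (s : Fin k → α) (l : Fin k) :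
    ¬ Injective (Fin.cons (s l) (Fin.cons b s) : Fin (k + 2) → α) := by
  intro h
  have := @h 0 l.succ.succ (by simp)
  simp [Fin.ext_iff] at this

namespace IsPositiveValuation

variable {k n : ℕ} {w : (Fin (k + 2) → Fin n) → ℕ∞}

lemma exchange_cons_cons (hw : IsPositiveValuation w) {p q p' q' : Fin n} {s : Fin k → Fin n}
    (h : w (Fin.cons p (Fin.cons q s)) ≠ ⊤) (h' : w (Fin.cons p' (Fin.cons q' s)) ≠ ⊤) :
    (w (Fin.cons p' (Fin.cons q s)) + w (Fin.cons p (Fin.cons q' s))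
        ≤ w (Fin.cons p (Fin.cons q s)) + w (Fin.cons p' (Fin.cons q' s)) ∧
      orderSign (Fin.cons p' (Fin.cons q s) : Fin (k + 2) → Fin n)
          * orderSign (Fin.cons p (Fin.cons q' s) : Fin (k + 2) → Fin n)
        = orderSign (Fin.cons p (Fin.cons q s) : Fin (k + 2) → Fin n)
          * orderSign (Fin.cons p' (Fin.cons q' s) : Fin (k + 2) → Fin n)) ∨
    (w (Fin.cons q' (Fin.cons q s)) + w (Fin.cons p' (Fin.cons p s))
        ≤ w (Fin.cons p (Fin.cons q s)) + w (Fin.cons p' (Fin.cons q' s)) ∧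
      orderSign (Fin.cons q' (Fin.cons q s) : Fin (k + 2) → Fin n)
          * orderSign (Fin.cons p' (Fin.cons p s) : Fin (k + 2) → Fin n)
        = orderSign (Fin.cons p (Fin.cons q s) : Fin (k + 2) → Fin n)
          * orderSign (Fin.cons p' (Fin.cons q' s) : Fin (k + 2) → Fin n)) := by
  obtain ⟨l, h1, h2⟩ := hw.exchange _ _ h h'
  revert h1 h2
  refine Fin.cases ?_ (fun l => ?_) l
  · simp only [update_cons_cons_zero, Fin.cons_zero]
    exact fun h1 h2 => Or.inl ⟨h1, h2⟩
  · refine Fin.cases ?_ (fun l => ?_) l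
    · simp only [update_cons_cons_zero, update_cons_cons_one, Fin.cons_zero, Fin.cons_succ]
      exact fun h1 h2 => Or.inr ⟨h1, h2⟩
    · intro h1
      simp only [update_cons_cons_zero, Fin.cons_zero, Fin.cons_succ] at h1
      rw [hw.eq_top _ (not_injective_cons_cons_apply q s l), top_add, top_le_iff] at h1
      exact absurd h1 (WithTop.add_ne_top.2 ⟨h, h'⟩)

lemma add_eq_min (hw : IsPositiveValuation w) (hfin : ∀ x, Injective x → w x ≠ ⊤)
    {a b c d : Fin n} (hab : a < b) (hbc : b < c) (hcd : c < d) {s : Fin k → Fin n}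
    (hbd' : Injective (Fin.cons b (Fin.cons d s) : Fin (k + 2) → Fin n))
    (hac' : Injective (Fin.cons a (Fin.cons c s) : Fin (k + 2) → Fin n))
    (had' : Injective (Fin.cons a (Fin.cons d s) : Fin (k + 2) → Fin n))
    (hbc' : Injective (Fin.cons b (Fin.cons c s) : Fin (k + 2) → Fin n))
    (hcd' : Injective (Fin.cons c (Fin.cons d s) : Fin (k + 2) → Fin n))
    (hab' : Injective (Fin.cons a (Fin.cons b s) : Fin (k + 2) → Fin n)) :
    w (Fin.cons b (Fin.cons d s)) + w (Fin.cons a (Fin.cons c s))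
      = min (w (Fin.cons a (Fin.cons d s)) + w (Fin.cons b (Fin.cons c s)))
        (w (Fin.cons c (Fin.cons d s)) + w (Fin.cons a (Fin.cons b s))) := by
  have hac := hab.trans hbc
  have hbd := hbc.trans hcd
  have had := hab.trans hbd
  have h0 := mul_ne_zero (orderSign_ne_zero.2 had') (orderSign_ne_zero.2 hbc')
  rw [orderSign_cons_cons_of_lt had, orderSign_cons_cons_of_lt hbc] at h0
  refine le_antisymm (le_min ?_ ?_) ?_
  · rcases hw.exchange_cons_cons (hfin _ had') (hfin _ hbc') with h | h
    · exact h.1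
    · have := h.2
      rw [orderSign_cons_cons_of_lt had, orderSign_cons_cons_of_lt hbc,
        orderSign_cons_cons_comm b a, orderSign_cons_cons_of_lt hab,
        orderSign_cons_cons_of_lt hcd] at this
      exact absurd (by linarith) h0
  · rcases hw.exchange_cons_cons (hfin _ hcd') (hfin _ hab') with h | h
    · have := h.2
      rw [orderSign_cons_cons_of_lt had, orderSign_cons_cons_comm c b,
        orderSign_cons_cons_of_lt hbc, orderSign_cons_cons_of_lt hab,
        orderSign_cons_cons_of_lt hcd] at this
      exact absurd (by linarith) h0
    · exact h.1
  · rcases hw.exchange_cons_cons (hfin _ hbd') (hfin _ hac') with h | h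
    · exact (min_le_left _ _).trans h.1
    · exact (min_le_right _ _).trans h.1

end IsPositiveValuation

section Minors

variable {K : Type*} [Field K]

/-- The ordered minor of the vectors `v` in the columns `x`. -/
def minor {k n : ℕ} (v : Fin n → Fin k → K) (x : Fin k → Fin n) : K :=
  (Matrix.of fun i j => v (x j) i).det

lemma minor_congr {k n : ℕ} {v v' : Fin n → Fin k → K} {x : Fin k → Fin n}
    (h : ∀ i, v (x i) = v' (x i)) : minor v x = minor v' x := by
  unfold minor
  simp only [h]

lemma minor_comp_perm {k n : ℕ} (v : Fin n → Fin k → K) (x : Fin k → Fin n)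
    (σ : Equiv.Perm (Fin k)) : minor v (x ∘ σ) = Equiv.Perm.sign σ * minor v x := by
  unfold minor
  rw [← Matrix.det_permute']
  rfl

lemma minor_of_not_injective {k n : ℕ} (v : Fin n → Fin k → K) {x : Fin k → Fin n}
    (hx : ¬ Injective x) : minor v x = 0 := by
  simp only [Injective, not_forall] at hx
  obtain ⟨i, j, h, hij⟩ := hx
  exact Matrix.det_zero_of_column_eq hij fun l => by simp [h]

lemma minor_update {k n : ℕ} (v : Fin n → Fin k → K) (x : Fin k → Fin n) (i : Fin k)
    (a : Fin n) :
    minor v (update x i a) = (Matrix.of fun i j => v (x j) i).cramer (v a) i := by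
  rw [Matrix.cramer_apply, minor]
  congr 1
  ext l j
  rcases eq_or_ne j i with rfl | h
  · simp
  · simp [h]

/-- The Grassmann–Plücker relations. -/
lemma minor_mul_minor {k n : ℕ} (v : Fin n → Fin k → K) (x y : Fin k → Fin n) (i : Fin k) :
    minor v x * minor v y
      = ∑ l, minor v (update x i (y l)) * minor v (update y l (x i)) := by
  have h := Matrix.mulVec_cramer (Matrix.of fun i j => v (y j) i) (v (x i))
  have hx : minor v x = (Matrix.of fun i j => v (x j) i).cramer (v (x i)) i := by
    rw [← minor_update, update_eq_self]
  have hsum : Matrix.det (Matrix.of fun i j => v (y j) i) • v (x i)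
      = ∑ l, minor v (update y l (x i)) • v (y l) := by
    rw [← h]
    funext j
    simp [Matrix.mulVec, dotProduct, minor_update, mul_comm]
  calc _ = (Matrix.of fun i j => v (x j) i).cramer
        (Matrix.det (Matrix.of fun i j => v (y j) i) • v (x i)) i := by
        rw [map_smul, Pi.smul_apply, ← hx, smul_eq_mul, mul_comm]; rfl
    _ = _ := by
      rw [hsum, map_sum, Finset.sum_apply]
      refine Finset.sum_congr rfl fun l _ => ?_
      rw [map_smul, Pi.smul_apply, smul_eq_mul, minor_update v x, mul_comm]

lemma minor_cons_cons_mul {k n : ℕ} (v : Fin n → Fin (k + 2) → K) (p q p' q' : Fin n)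
    (s : Fin k → Fin n) :
    minor v (Fin.cons p (Fin.cons q s)) * minor v (Fin.cons p' (Fin.cons q' s))
      = minor v (Fin.cons p' (Fin.cons q s)) * minor v (Fin.cons p (Fin.cons q' s))
        + minor v (Fin.cons q' (Fin.cons q s)) * minor v (Fin.cons p' (Fin.cons p s)) := by
  rw [minor_mul_minor v _ _ 0, Fin.sum_univ_succ, Fin.sum_univ_succ, Finset.sum_eq_zero]
  · simp only [update_cons_cons_zero, update_cons_cons_one, Fin.cons_zero, Fin.cons_succ,
      add_zero]
  · intro l _
    simp only [update_cons_cons_zero, Fin.cons_succ]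
    rw [minor_of_not_injective v (not_injective_cons_cons_apply q s l), zero_mul]

/-- The minor in the columns `x`, sorted increasingly. -/
def sortedMinor {k n : ℕ} (v : Fin n → Fin k → K) (x : Fin k → Fin n) : K :=
  orderSign x * minor v x

lemma sortedMinor_comp_perm {k n : ℕ} (v : Fin n → Fin k → K) (x : Fin k → Fin n)
    (σ : Equiv.Perm (Fin k)) : sortedMinor v (x ∘ σ) = sortedMinor v x := by
  unfold sortedMinor
  rw [minor_comp_perm, orderSign_comp_perm]
  rcases Int.units_eq_one_or (Equiv.Perm.sign σ) with h | h <;> simp [h]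

lemma minor_eq {k n : ℕ} (v : Fin n → Fin k → K) {x : Fin k → Fin n} (hx : Injective x) :
    minor v x = orderSign x * sortedMinor v x := by
  have := congrArg (Int.cast : ℤ → K) (orderSign_mul_self hx)
  push_cast at this
  rw [sortedMinor, ← mul_assoc, this, one_mul]

lemma sortedMinor_cons_cons_mul {k n : ℕ} (v : Fin n → Fin (k + 2) → K) {a b c d : Fin n}
    (hab : a < b) (hbc : b < c) (hcd : c < d) (s : Fin k → Fin n) :
    sortedMinor v (Fin.cons b (Fin.cons d s)) * sortedMinor v (Fin.cons a (Fin.cons c s))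
      = sortedMinor v (Fin.cons a (Fin.cons d s)) * sortedMinor v (Fin.cons b (Fin.cons c s))
        + sortedMinor v (Fin.cons c (Fin.cons d s))
          * sortedMinor v (Fin.cons a (Fin.cons b s)) := by
  have hac := hab.trans hbc
  have hbd := hbc.trans hcd
  have had := hab.trans hbd
  unfold sortedMinor
  rw [orderSign_cons_cons_of_lt had, orderSign_cons_cons_of_lt hbc,
    orderSign_cons_cons_of_lt hbd, orderSign_cons_cons_of_lt hac,
    orderSign_cons_cons_of_lt hcd, orderSign_cons_cons_of_lt hab]
  push_cast
  linear_combination (insertSign s a * insertSign s b * insertSign s c * insertSign s d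
    * orderSign s * orderSign s : K) * minor_cons_cons_mul v b d a c s

end Minors

section Lifting

variable {K : Type*} [Field K] [LinearOrder K] [IsStrictOrderedRing K]

/-- The sorted minor of `v` at `x` is positive, with the leading order in `ε` prescribed
by `w`. -/
def LiftsAt {k n : ℕ} (ε : K) (w : (Fin k → Fin n) → ℕ∞) (v : Fin n → Fin k → K)
    (x : Fin k → Fin n) : Prop :=
  0 < sortedMinor v x ∧
    ArchimedeanClass.mk (sortedMinor v x) = (w x).toNat • ArchimedeanClass.mk ε

lemma archimedeanClassMk_add_of_pos {x y : K} (hx : 0 < x) (hy : 0 < y) :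
    ArchimedeanClass.mk (x + y) = min (ArchimedeanClass.mk x) (ArchimedeanClass.mk y) := by
  refine le_antisymm (le_min ?_ ?_) (ArchimedeanClass.min_le_mk_add x y)
  · exact ArchimedeanClass.mk_antitoneOn hx.le (add_pos hx hy).le (by linarith)
  · exact ArchimedeanClass.mk_antitoneOn hy.le (add_pos hx hy).le (by linarith)

variable {ε : K}

namespace LiftsAt

lemma comp_perm_iff {r n : ℕ} {w : (Fin (r + 1) → Fin n) → ℕ∞} (hw : IsPositiveValuation w)
    {v : Fin n → Fin (r + 1) → K} {x : Fin (r + 1) → Fin n} (σ : Equiv.Perm (Fin (r + 1))) :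
    LiftsAt ε w v (x ∘ σ) ↔ LiftsAt ε w v x := by
  unfold LiftsAt
  rw [sortedMinor_comp_perm, hw.comp_perm]

lemma of_cons_cons {k n : ℕ} {w : (Fin (k + 2) → Fin n) → ℕ∞} (hw : IsPositiveValuation w)
    (hfin : ∀ x, Injective x → w x ≠ ⊤) (hε : 0 < ArchimedeanClass.mk ε)
    {v : Fin n → Fin (k + 2) → K} {a b c d : Fin n} (hab : a < b) (hbc : b < c) (hcd : c < d)
    {s : Fin k → Fin n} (hbd' : Injective (Fin.cons b (Fin.cons d s) : Fin (k + 2) → Fin n))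
    (ha : a ∉ Set.range s) (hc : c ∉ Set.range s)
    (Lad : LiftsAt ε w v (Fin.cons a (Fin.cons d s)))
    (Lbc : LiftsAt ε w v (Fin.cons b (Fin.cons c s)))
    (Lcd : LiftsAt ε w v (Fin.cons c (Fin.cons d s)))
    (Lab : LiftsAt ε w v (Fin.cons a (Fin.cons b s)))
    (Lac : LiftsAt ε w v (Fin.cons a (Fin.cons c s))) :
    LiftsAt ε w v (Fin.cons b (Fin.cons d s)) := by
  have hac := hab.trans hbc
  have hbd := hbc.trans hcd
  have had := hab.trans hbd
  have hinj : ∀ p q : Fin n, p ≠ q → p ∉ Set.range s → q ∉ Set.range s →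
      Injective (Fin.cons p (Fin.cons q s) : Fin (k + 2) → Fin n) := by
    intro p q hpq hp hq
    rw [Fin.cons_injective_iff, Fin.cons_injective_iff, Fin.range_cons, Set.mem_insert_iff]
    rw [Fin.cons_injective_iff, Fin.cons_injective_iff] at hbd'
    exact ⟨fun h => h.elim hpq hp, hq, hbd'.2.2⟩
  have hbd'' := hbd'
  rw [Fin.cons_injective_iff, Fin.cons_injective_iff, Fin.range_cons, Set.mem_insert_iff,
    not_or] at hbd''
  obtain ⟨⟨-, hb⟩, hd, -⟩ := hbd''
  have iac := hinj a c hac.ne ha hc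
  have iad := hinj a d had.ne ha hd
  have ibc := hinj b c hbc.ne hb hc
  have icd := hinj c d hcd.ne hc hd
  have iab := hinj a b hab.ne ha hb
  have hmul := sortedMinor_cons_cons_mul v hab hbc hcd s
  have hmin := hw.add_eq_min hfin hab hbc hcd hbd' iac iad ibc icd iab
  have p1 := mul_pos Lad.1 Lbc.1
  have p2 := mul_pos Lcd.1 Lab.1
  have hpos : 0 < sortedMinor v (Fin.cons b (Fin.cons d s)) :=
    pos_of_mul_pos_left (hmul ▸ add_pos p1 p2) Lac.1.le
  refine ⟨hpos, ?_⟩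
  have hmk := congrArg ArchimedeanClass.mk hmul
  rw [archimedeanClassMk_add_of_pos p1 p2] at hmk
  simp only [ArchimedeanClass.mk_mul] at hmk
  have hne : ArchimedeanClass.mk (sortedMinor v (Fin.cons a (Fin.cons c s))) ≠ ⊤ := by
    rw [Ne, ArchimedeanClass.mk_eq_top_iff]
    exact Lac.1.ne'
  refine ArchimedeanClass.add_right_cancel_of_ne_top hne ?_
  rw [hmk, Lac.2, Lad.2, Lbc.2, Lcd.2, Lab.2]
  simp only [← add_nsmul]
  rw [← ENat.natCast_toNat (hfin _ hbd'), ← ENat.natCast_toNat (hfin _ iac),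
    ← ENat.natCast_toNat (hfin _ iad), ← ENat.natCast_toNat (hfin _ ibc),
    ← ENat.natCast_toNat (hfin _ icd), ← ENat.natCast_toNat (hfin _ iab)] at hmin
  have hmin' : (w (Fin.cons b (Fin.cons d s))).toNat + (w (Fin.cons a (Fin.cons c s))).toNat
      = min ((w (Fin.cons a (Fin.cons d s))).toNat + (w (Fin.cons b (Fin.cons c s))).toNat)
        ((w (Fin.cons c (Fin.cons d s))).toNat + (w (Fin.cons a (Fin.cons b s))).toNat) := by
    refine Nat.cast_injective (R := ℕ∞) ?_
    rw [Nat.mono_cast.map_min]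
    push_cast
    exact hmin
  rw [hmin']
  exact ((nsmul_left_monotone hε.le).map_min).symm

end LiftsAt

/-- The initial segment up to `p`, followed by the final segment below and including `m`. -/
def seedTuple {r n : ℕ} (m : Fin n) (p : Fin (r + 1)) (i : Fin (r + 1)) : Fin n :=
  if i < p then ⟨min i m, by omega⟩ else ⟨m - (r - i), by omega⟩

lemma seedTuple_strictMono {r n : ℕ} {m : Fin n} (hm : r < (m : ℕ)) (p : Fin (r + 1)) :
    StrictMono (seedTuple m p) := by
  intro i j hij
  unfold seedTuple
  rw [Fin.lt_def] at *
  split_ifs with h1 h2 h2 <;> simp only [Fin.lt_def] at * <;> omega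

lemma seedTuple_last {r n : ℕ} (m : Fin n) (p : Fin (r + 1)) :
    seedTuple m p (Fin.last r) = m := by
  unfold seedTuple
  rw [if_neg (by simpa using Fin.le_last p)]
  simp

/-- The elements of a set lying between two elements below `m` that are missing from it. -/
def enclosed {n : ℕ} (m : Fin n) (S : Set (Fin n)) : Set (Fin n) :=
  {b | b ∈ S ∧ (∃ a ∉ S, a < b) ∧ ∃ c ∉ S, b < c ∧ c < m}

lemma exists_enclosed_ssubset {n : ℕ} {m b : Fin n} {T : Set (Fin n)} (hb : b ∉ T)
    (h : b ∈ enclosed m (insert b T)) : ∃ a c, a ∉ T ∧ c ∉ T ∧ a < b ∧ b < c ∧ c < m ∧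
      enclosed m (insert a T) ⊂ enclosed m (insert b T) ∧
      enclosed m (insert c T) ⊂ enclosed m (insert b T) := by
  obtain ⟨-, ⟨a₀, ha₀, hab₀⟩, c₀, hc₀, hbc₀, hcm₀⟩ := id h
  obtain ⟨a, ha, hmin⟩ := WellFounded.has_min wellFounded_lt {g | g ∉ insert b T} ⟨a₀, ha₀⟩
  obtain ⟨c, ⟨hc, hcm⟩, hmax⟩ :=
    WellFounded.has_min wellFounded_gt {g | g ∉ insert b T ∧ g < m} ⟨c₀, hc₀, hcm₀⟩
  have hab : a < b := (not_lt.1 (hmin a₀ ha₀)).trans_lt hab₀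
  have hbc : b < c := hbc₀.trans_le (not_lt.1 (hmax c₀ ⟨hc₀, hcm₀⟩))
  have haT : a ∉ T := fun h => ha (Or.inr h)
  have hcT : c ∉ T := fun h => hc (Or.inr h)
  have hT : ∀ g, g ∉ T → g = b ∨ g ∉ insert b T := fun g hg => by
    rw [Set.mem_insert_iff]; tauto
  have key : ∀ g, g ∈ T → ∀ d, enclosed m (insert d T) g → enclosed m (insert b T) g := by
    rintro g hg d ⟨-, ⟨a', ha', hag⟩, c', hc', hgc, hcm'⟩
    refine ⟨Or.inr hg, ?_, ?_⟩
    · rcases hT a' fun h => ha' (Or.inr h) with rfl | h'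
      · exact ⟨a, ha, hab.trans hag⟩
      · exact ⟨a', h', hag⟩
    · rcases hT c' fun h => hc' (Or.inr h) with rfl | h'
      · exact ⟨c, hc, hgc.trans hbc, hcm⟩
      · exact ⟨c', h', hgc, hcm'⟩
  refine ⟨a, c, haT, hcT, hab, hbc, hcm, ⟨fun e he => ?_, fun hsub => ?_⟩,
    ⟨fun e he => ?_, fun hsub => ?_⟩⟩
  · rcases he.1 with rfl | heT
    · obtain ⟨-, ⟨a', ha', hae⟩, -⟩ := he
      rcases hT a' fun h => ha' (Or.inr h) with rfl | h'
      · exact absurd (hae.trans hab) (lt_irrefl _)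
      · exact absurd hae (hmin a' h')
    · exact key e heT a he
  · exact (hsub h).1.elim hab.ne' hb
  · rcases he.1 with rfl | heT
    · obtain ⟨-, -, c', hc', hec, hcm'⟩ := he
      rcases hT c' fun h => hc' (Or.inr h) with rfl | h'
      · exact absurd (hec.trans hbc) (lt_irrefl _)
      · exact absurd hec (hmax c' ⟨h', hcm'⟩)
    · exact key e heT c he
  · exact (hsub h).1.elim hbc.ne hb

lemma exists_comp_perm_eq_seedTuple {r n : ℕ} {m : Fin n} (hm : r < (m : ℕ))
    {x : Fin (r + 1) → Fin n} (hx : Injective x) (hle : ∀ i, x i ≤ m) (hmem : m ∈ Set.range x)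
    (he : enclosed m (Set.range x) = ∅) :
    ∃ (p : Fin (r + 1)) (σ : Equiv.Perm (Fin (r + 1))), x ∘ σ = seedTuple m p := by
  obtain ⟨σ, hσ⟩ := exists_perm_strictMono hx
  suffices ∃ p, x ∘ σ = seedTuple m p from let ⟨p, h⟩ := this; ⟨p, σ, h⟩
  rw [← σ.surjective.range_comp] at hmem he
  replace hle : ∀ i, (x ∘ σ) i ≤ m := fun i => hle _
  generalize x ∘ σ = z at *
  have hlast : z (Fin.last r) = m := by
    obtain ⟨j, hj⟩ := hmem
    exact le_antisymm (hle _) (hj ▸ hσ.monotone (Fin.le_last j))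
  obtain ⟨p, hp, hmin⟩ := WellFounded.has_min wellFounded_lt {i | (z i : ℕ) ≠ i}
    ⟨Fin.last r, by simpa [hlast] using hm.ne'⟩
  have hpz : (p : ℕ) < z p := by
    by_contra h
    have hlt : (z p : ℕ) < p := lt_of_le_of_ne (not_lt.1 h) hp
    have := hmin ⟨z p, by omega⟩
    simp only [Set.mem_ofPred_eq, Fin.lt_def, hlt, not_true_eq_false, imp_false,
      not_not] at this
    have := hσ.injective (Fin.ext this)
    simp only [Fin.ext_iff] at this
    omega
  have hlow : ∀ i, i < p → (z i : ℕ) = i := fun i hi => by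
    by_contra h
    exact hmin i h hi
  have hgap : (⟨p, by omega⟩ : Fin n) ∉ Set.range z := by
    rintro ⟨i, hi⟩
    simp only [Fin.ext_iff] at hi
    rcases lt_or_ge i p with h | h
    · have := hlow i h
      rw [Fin.lt_def] at h
      omega
    · have := Fin.le_def.1 (hσ.monotone h)
      omega
  have hhigh : ∀ t, ∀ i, p ≤ i → (i : ℕ) + t = r → (z i : ℕ) + t = m := by
    intro t
    induction t with
    | zero =>
      intro i _ hi
      obtain rfl : i = Fin.last r := Fin.ext hi
      rw [hlast, add_zero]
    | succ t ih =>
      intro i hpi hi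
      have e := ih ⟨i + 1, by omega⟩ (hpi.trans (Fin.le_def.2 (Nat.le_succ _)))
        (by simp only; omega)
      have hlt : z i < z ⟨i + 1, by omega⟩ := hσ (Fin.lt_def.2 (Nat.lt_succ_self _))
      rw [Fin.lt_def] at hlt
      by_contra hne
      have : z i ∈ enclosed m (Set.range z) := by
        refine ⟨⟨i, rfl⟩, ⟨_, hgap, Fin.lt_def.2 (hpz.trans_le ?_)⟩,
          ⟨z i + 1, by omega⟩, ?_, Fin.lt_def.2 (Nat.lt_succ_self _), Fin.lt_def.2 ?_⟩
        · exact Fin.le_def.1 (hσ.monotone hpi)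
        · rintro ⟨j, hj⟩
          have h1 : z i < z j := by rw [hj]; exact Fin.lt_def.2 (Nat.lt_succ_self _)
          have h2 : z j < z ⟨i + 1, by omega⟩ := by
            rw [hj, Fin.lt_def]; simp only; omega
          rw [hσ.lt_iff_lt, Fin.lt_def] at h1 h2
          simp only at h2
          omega
        · simp only; omega
      rw [he] at this
      exact this
  refine ⟨p, funext fun i => Fin.ext ?_⟩
  unfold seedTuple
  split_ifs with h
  · rw [hlow i h]
    rw [Fin.lt_def] at h
    simp only
    omega
  · have := hhigh (r - i) i (not_lt.1 h) (by omega)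
    simp only
    omega

/-- The columns below `m` being realized, column `m` can be chosen with prescribed minors at
all seed tuples. -/
lemma exists_column_s15 {r n : ℕ} {w : (Fin (r + 1) → Fin n) → ℕ∞} {v : Fin n → Fin (r + 1) → K}
    {m : Fin n} (hm : r < (m : ℕ))
    (hv : ∀ x, Injective x → (∀ i, x i < m) → LiftsAt ε w v x) (t : Fin (r + 1) → K) :
    ∃ u, ∀ p, minor (update v m u) (seedTuple m p) = t p := by
  let col : Fin (r + 1) → Fin n := fun j => ⟨j, by omega⟩
  let Φ : Matrix (Fin (r + 1)) (Fin (r + 1)) K :=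
    Matrix.of fun p j => minor v (update (seedTuple m p) (Fin.last r) (col j))
  have hlt : ∀ (p : Fin (r + 1)) (j : Fin (r + 1)), j ≠ Fin.last r →
      seedTuple m p j < m := fun p j hj => by
    conv_rhs => rw [← seedTuple_last m p]
    exact seedTuple_strictMono hm p (Fin.lt_last_iff_ne_last.2 hj)
  have hΦ : Φ.det ≠ 0 := by
    have htri : Φ.BlockTriangular id := by
      intro p j hjp
      have hjp : j < p := hjp
      have hjl : j ≠ Fin.last r := (hjp.trans_le (Fin.le_last p)).ne
      refine minor_of_not_injective v fun hinj => hjl (hinj ?_)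
      rw [update_self, update_of_ne hjl]
      unfold seedTuple
      rw [if_pos hjp]
      rw [Fin.lt_def] at hjp
      simp only [col, Fin.ext_iff]
      omega
    rw [Matrix.det_of_isUpperTriangular htri]
    refine Finset.prod_ne_zero_iff.2 fun p _ h0 => ?_
    have hL : LiftsAt ε w v (update (seedTuple m p) (Fin.last r) (col p)) := by
      refine hv _ ?_ fun i => ?_
      · have hne : ∀ i, i ≠ Fin.last r → seedTuple m p i ≠ col p := fun i hi h => by
          simp only [seedTuple, col, Fin.ext_iff] at h
          rw [Fin.lt_last_iff_ne_last.symm, Fin.lt_def, Fin.val_last] at hi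
          split_ifs at h with h1 <;> simp only [Fin.lt_def] at h h1 <;> omega
        intro i j hij
        by_cases hi : i = Fin.last r <;> by_cases hj : j = Fin.last r
        · rw [hi, hj]
        · rw [hi, update_self, update_of_ne hj] at hij
          exact absurd hij.symm (hne j hj)
        · rw [hj, update_self, update_of_ne hi] at hij
          exact absurd hij (hne i hi)
        · rw [update_of_ne hi, update_of_ne hj] at hij
          exact (seedTuple_strictMono hm p).injective hij
      · by_cases hi : i = Fin.last r
        · rw [hi, update_self, Fin.lt_def]
          simp only [col]
          omega
        · rw [update_of_ne hi]
          exact hlt p i hi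
    have h0 : minor v (update (seedTuple m p) (Fin.last r) (col p)) = 0 := h0
    have := hL.1
    rw [sortedMinor, h0, mul_zero] at this
    exact lt_irrefl _ this
  refine ⟨∑ j, (Φ⁻¹.mulVec t) j • v (col j), fun p => ?_⟩
  have hcr : ∀ u, minor (update v m u) (seedTuple m p)
      = (Matrix.of fun i j => v (seedTuple m p j) i).cramer u (Fin.last r) := fun u => by
    rw [Matrix.cramer_apply, minor]
    congr 1
    ext l j
    by_cases hj : j = Fin.last r
    · simp [hj, seedTuple_last]
    · simp [hj, (hlt p j hj).ne]
  rw [hcr, map_sum, Finset.sum_apply]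
  have := congrFun (Matrix.mulVec_mulVec t Φ Φ⁻¹) p
  rw [Matrix.mul_nonsing_inv Φ (isUnit_iff_ne_zero.2 hΦ), Matrix.one_mulVec] at this
  rw [← this, Matrix.mulVec, dotProduct]
  refine Finset.sum_congr rfl fun j _ => ?_
  rw [map_smul, Pi.smul_apply, smul_eq_mul, ← minor_update, mul_comm]
  rfl

end Lifting

section Lifting

variable {K : Type*} [Field K] [LinearOrder K] [IsStrictOrderedRing K] {ε : K}

lemma liftsAt_of_seedTuple {r n : ℕ} {w : (Fin (r + 1) → Fin n) → ℕ∞}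
    (hw : IsPositiveValuation w) (hfin : ∀ x, Injective x → w x ≠ ⊤)
    (hε : 0 < ArchimedeanClass.mk ε) {v : Fin n → Fin (r + 1) → K} {m : Fin n}
    (hm : r < (m : ℕ)) (hlow : ∀ x, Injective x → (∀ i, x i < m) → LiftsAt ε w v x)
    (hseed : ∀ p, LiftsAt ε w v (seedTuple m p)) (x : Fin (r + 1) → Fin n)
    (hx : Injective x) (hle : ∀ i, x i ≤ m) : LiftsAt ε w v x := by
  induction hN : (enclosed m (Set.range x)).ncard using Nat.strong_induction_on
    generalizing x with
  | _ N ih =>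
  by_cases hmem : m ∈ Set.range x
  swap
  · exact hlow x hx fun i => lt_of_le_of_ne (hle i) fun h => hmem ⟨i, h⟩
  rcases Set.eq_empty_or_nonempty (enclosed m (Set.range x)) with he | ⟨b, hb⟩
  · obtain ⟨p, σ, hσ⟩ := exists_comp_perm_eq_seedTuple hm hx hle hmem he
    rw [← LiftsAt.comp_perm_iff hw σ, hσ]
    exact hseed p
  have hbm : b < m := by
    obtain ⟨-, -, c, -, hbc, hcm⟩ := hb
    exact hbc.trans hcm
  obtain ⟨i, hi⟩ := hb.1
  obtain ⟨j, hj⟩ := hmem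
  have hij : i ≠ j := by
    rintro rfl
    exact hbm.ne (hi.symm.trans hj)
  obtain ⟨k, rfl⟩ : ∃ k, r = k + 1 :=
    Nat.exists_eq_succ_of_ne_zero fun h => by
      subst h
      exact hij (Fin.ext (by omega))
  obtain ⟨σ, s, hσ⟩ := exists_perm_comp_eq_cons_cons x hij
  rw [hi, hj] at hσ
  have hrange : Set.range x = insert b (Set.range (Fin.cons m s : Fin (k + 1) → Fin n)) := by
    rw [← σ.surjective.range_comp, hσ, Fin.range_cons]
  have hyi : Injective (x ∘ σ) := hx.comp σ.injective
  have hyle : ∀ i, (x ∘ σ) i ≤ m := fun i => hle _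
  rw [← LiftsAt.comp_perm_iff hw σ]
  rw [hσ] at hyi hyle ⊢
  have hyi' := Fin.cons_injective_iff.1 hyi
  have hsle : ∀ i, s i ≤ m := fun i => by simpa using hyle i.succ.succ
  have hslt : ∀ i, s i < m := fun i => lt_of_le_of_ne (hsle i) fun h =>
    (Fin.cons_injective_iff.1 hyi'.2).1 ⟨i, h⟩
  have hsi : Injective s := (Fin.cons_injective_iff.1 hyi'.2).2
  rw [hrange] at hb
  obtain ⟨a, c, ha, hc, hab, hbc, hcm, hsa, hsc⟩ := exists_enclosed_ssubset hyi'.1 hb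
  have hs : ∀ g, g ∉ Set.range (Fin.cons m s : Fin (k + 1) → Fin n) → g ∉ Set.range s := by
    intro g hg h
    rw [Fin.range_cons] at hg
    exact hg (Or.inr h)
  have hcons : ∀ g, g ∉ Set.range (Fin.cons m s : Fin (k + 1) → Fin n) → g ≤ m →
      enclosed m (insert g (Set.range (Fin.cons m s : Fin (k + 1) → Fin n)))
        ⊂ enclosed m (insert b (Set.range (Fin.cons m s : Fin (k + 1) → Fin n))) →
      LiftsAt ε w v (Fin.cons g (Fin.cons m s)) := by
    intro g hg hgm hss
    refine ih _ ?_ _ (Fin.cons_injective_iff.2 ⟨hg, hyi'.2⟩) (fun i => ?_) rfl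
    · rw [← hN, Fin.range_cons, hrange]
      exact Set.ncard_lt_ncard hss
    · refine Fin.cases ?_ (fun i => ?_) i
      · simpa using hgm
      · refine Fin.cases ?_ (fun i => ?_) i
        · simp
        · simpa using hsle i
  have hlow' : ∀ g h, g ∉ Set.range s → h ∉ Set.range s → g ≠ h → g < m → h < m →
      LiftsAt ε w v (Fin.cons g (Fin.cons h s)) := by
    intro g h hg hh hgh hgm hhm
    refine hlow _ ?_ fun i => ?_
    · rw [Fin.cons_injective_iff, Fin.cons_injective_iff, Fin.range_cons]
      exact ⟨fun h => h.elim hgh hg, hh, hsi⟩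
    · refine Fin.cases ?_ (fun i => ?_) i
      · simpa using hgm
      · refine Fin.cases ?_ (fun i => ?_) i
        · simpa using hhm
        · simpa using hslt i
  have has := hs a ha
  have hbs := hs b hyi'.1
  have hcs := hs c hc
  have ham := hab.trans hbm
  exact LiftsAt.of_cons_cons hw hfin hε hab hbc hcm hyi has hcs
    (hcons a ha ham.le hsa) (hlow' b c hbs hcs hbc.ne hbm hcm) (hcons c hc hcm.le hsc)
    (hlow' a b has hbs hab.ne ham hbm) (hlow' a c has hcs (hab.trans hbc).ne ham hcm)

lemma exists_liftsAt_of_lt {r n : ℕ} {w : (Fin (r + 1) → Fin n) → ℕ∞}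
    (hw : IsPositiveValuation w) (hfin : ∀ x, Injective x → w x ≠ ⊤) (h0 : 0 < ε)
    (hε : 0 < ArchimedeanClass.mk ε) {m : ℕ} (hrm : r + 1 ≤ m) (hmn : m ≤ n) :
    ∃ v : Fin n → Fin (r + 1) → K, ∀ x : Fin (r + 1) → Fin n, Injective x →
      (∀ i, (x i : ℕ) < m) → LiftsAt ε w v x := by
  have hpow : ∀ x : Fin (r + 1) → Fin n, StrictMono x → ∀ v : Fin n → Fin (r + 1) → K,
      minor v x = ε ^ (w x).toNat → LiftsAt ε w v x := by
    intro x hx v hv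
    unfold LiftsAt sortedMinor
    rw [orderSign_of_strictMono hx, hv, Int.cast_one, one_mul]
    exact ⟨pow_pos h0 _, ArchimedeanClass.mk_pow _ _⟩
  induction m, hrm using Nat.le_induction with
  | base =>
    refine ⟨fun j i => if (j : ℕ) = i then if i = 0 then ε ^ (w (Fin.castLE hmn)).toNat else 1
      else 0, fun x hx hlt => ?_⟩
    have hσ : Injective fun i => (⟨x i, hlt i⟩ : Fin (r + 1)) := fun i j h =>
      hx (by simpa [Fin.ext_iff] using h)
    let σ : Equiv.Perm (Fin (r + 1)) :=
      Equiv.ofBijective _ (Finite.injective_iff_bijective.1 hσ)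
    have hxσ : x = Fin.castLE hmn ∘ σ := funext fun i => Fin.ext rfl
    rw [hxσ, LiftsAt.comp_perm_iff hw]
    refine hpow _ (Fin.strictMono_castLE hmn) _ ?_
    have hdiag : (Matrix.of fun i j : Fin (r + 1) =>
        if ((Fin.castLE hmn j : Fin n) : ℕ) = i then
          if i = 0 then ε ^ (w (Fin.castLE hmn)).toNat else 1 else 0)
        = Matrix.diagonal fun i => if i = 0 then ε ^ (w (Fin.castLE hmn)).toNat else 1 := by
      ext i j
      rw [Matrix.diagonal_apply]
      simp only [Matrix.of_apply, Fin.val_castLE, Fin.ext_iff, eq_comm (a := (j : ℕ))]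
    rw [minor, hdiag, Matrix.det_diagonal, Finset.prod_ite_eq']
    simp
  | succ m hrm ih =>
    obtain ⟨v, hv⟩ := ih (by omega)
    obtain ⟨u, hu⟩ := exists_column_s15 (m := ⟨m, hmn⟩) hrm
      (fun x hx hlt => hv x hx fun i => hlt i) fun p => ε ^ (w (seedTuple ⟨m, hmn⟩ p)).toNat
    refine ⟨update v ⟨m, hmn⟩ u, fun x hx hlt =>
      liftsAt_of_seedTuple hw hfin hε (m := ⟨m, hmn⟩) hrm (fun x hx hlt => ?_) (fun p => ?_)
        x hx fun i => Nat.lt_succ_iff.1 (hlt i)⟩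
    · have := hv x hx fun i => hlt i
      unfold LiftsAt sortedMinor at this ⊢
      rwa [minor_congr (v' := v) fun i => update_of_ne (hlt i).ne _ _]
    · exact hpow _ (seedTuple_strictMono hrm p) _ (hu p)

lemma exists_liftsAt {r n : ℕ} {w : (Fin (r + 1) → Fin n) → ℕ∞}
    (hw : IsPositiveValuation w) (hfin : ∀ x, Injective x → w x ≠ ⊤) (h0 : 0 < ε)
    (hε : 0 < ArchimedeanClass.mk ε) (hrn : r + 1 ≤ n) :
    ∃ v : Fin n → Fin (r + 1) → K, ∀ x, Injective x → LiftsAt ε w v x := by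
  obtain ⟨v, hv⟩ := exists_liftsAt_of_lt hw hfin h0 hε hrn le_rfl
  exact ⟨v, fun x hx => hv x hx fun i => (x i).isLt⟩

end Lifting

section StandardPart

open ArchimedeanClass

variable {K : Type*} [Field K] [LinearOrder K] [IsStrictOrderedRing K]

lemma det_map_stdPart {k : ℕ} (M : Matrix (Fin k) (Fin k) K)
    (hM : ∀ i j, 0 ≤ ArchimedeanClass.mk (M i j)) :
    (M.map stdPart).det = stdPart M.det := by
  let incl : FiniteElement K →+* K :=
    { toFun := fun x => x.1
      map_one' := rfl
      map_mul' := fun _ _ => rfl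
      map_zero' := rfl
      map_add' := fun _ _ => rfl }
  let std : FiniteElement K →+* ℝ :=
    { toFun := fun x => stdPart x.1
      map_one' := stdPart_one
      map_mul' := fun x y => stdPart_mul x.2 y.2
      map_zero' := stdPart_zero
      map_add' := fun x y => stdPart_add x.2 y.2 }
  let N : Matrix (Fin k) (Fin k) (FiniteElement K) :=
    Matrix.of fun i j => FiniteElement.mk (M i j) (hM i j)
  have h1 : incl N.det = M.det := incl.map_det N
  have h2 : std N.det = (M.map stdPart).det := std.map_det N
  rw [← h1, ← h2]
  rfl

end StandardPart

/-- A valuation finite on all injective tuples yields a real matrix whose nonzero minors are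
the tuples of valuation zero. -/
lemma IsPositiveValuation.exists_matrix {r n : ℕ} {w : (Fin (r + 1) → Fin n) → ℕ∞}
    (hw : IsPositiveValuation w) (hfin : ∀ x, Injective x → w x ≠ ⊤) (hzero : ∃ b, w b = 0)
    (hrn : r + 1 ≤ n) : ∃ A : Matrix (Fin (r + 1)) (Fin n) ℝ, ∀ x : Fin (r + 1) → Fin n,
      Real.sign (A.submatrix id x).det = if w x = 0 then (orderSign x : ℝ) else 0 := by
  have hε := Hyperreal.archimedeanClassMk_epsilon_pos
  obtain ⟨v, hv⟩ := exists_liftsAt hw hfin Hyperreal.epsilon_pos hε hrn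
  obtain ⟨b, hb⟩ := hzero
  obtain ⟨σ, hσ⟩ := exists_perm_strictMono (hw.injective (x := b) (by simp [hb]))
  rw [← hw.comp_perm b σ] at hb
  generalize b ∘ σ = b at hb hσ
  obtain ⟨hbpos, hbmk⟩ := hv b hσ.injective
  have hbminor : sortedMinor v b = minor v b := by
    rw [sortedMinor, orderSign_of_strictMono hσ, Int.cast_one, one_mul]
  rw [hbminor] at hbpos hbmk
  rw [hb, ENat.toNat_zero, zero_nsmul] at hbmk
  set B : Matrix (Fin (r + 1)) (Fin (r + 1)) Hyperreal := Matrix.of fun i j => v (b j) i with hB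
  have hBdet : B.det = minor v b := rfl
  let u : Fin n → Fin (r + 1) → Hyperreal := fun j => (minor v b)⁻¹ • B.cramer (v j)
  have hu : ∀ x, minor u x = minor v x / minor v b := by
    intro x
    rw [eq_div_iff hbpos.ne', mul_comm, ← hBdet, minor, ← Matrix.det_mul, minor]
    congr 1
    ext i j
    have : B.mulVec (u (x j)) = v (x j) := by
      rw [Matrix.mulVec_smul, Matrix.mulVec_cramer, hBdet, smul_smul,
        inv_mul_cancel₀ hbpos.ne', one_smul]
    exact congrFun this i
  have hmk : ∀ x, Injective x →
      ArchimedeanClass.mk (minor u x) = (w x).toNat • ArchimedeanClass.mk Hyperreal.epsilon := by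
    intro x hx
    rw [hu, ArchimedeanClass.mk_div, hbmk, sub_zero, ← (hv x hx).2, minor_eq v hx,
      ArchimedeanClass.mk_mul, ArchimedeanClass.mk_intCast (orderSign_ne_zero.2 hx), zero_add]
  have hent : ∀ i j, 0 ≤ ArchimedeanClass.mk (u j i) := by
    intro i j
    have : u j i = minor u (update b i j) := by
      rw [hu, minor_update, div_eq_inv_mul]
      rfl
    rw [this]
    by_cases hinj : Injective (update b i j)
    · rw [hmk _ hinj]
      exact nsmul_nonneg hε.le _
    · rw [minor_of_not_injective u hinj, ArchimedeanClass.mk_zero]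
      exact le_top
  refine ⟨Matrix.of fun i j => ArchimedeanClass.stdPart (u j i), fun x => ?_⟩
  have hdet : ((Matrix.of fun i j => ArchimedeanClass.stdPart (u j i)).submatrix id x).det
      = ArchimedeanClass.stdPart (minor u x) := by
    exact det_map_stdPart (Matrix.of fun i j => u (x j) i) fun i j => hent i (x j)
  rw [hdet]
  by_cases hx : Injective x
  swap
  · rw [minor_of_not_injective u hx, ArchimedeanClass.stdPart_zero, Real.sign_zero, if_neg]
    simp [hw.eq_top x hx]
  split_ifs with h0
  · have hne : ArchimedeanClass.stdPart (minor u x) ≠ 0 := by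
      rw [Ne, ArchimedeanClass.stdPart_eq_zero, not_not, hmk x hx, h0]
      simp
    have hpos := div_pos (hv x hx).1 hbpos
    rw [hu, minor_eq v hx, mul_div_assoc] at hne ⊢
    have hsq := orderSign_mul_self hx
    rcases Int.eq_one_or_neg_one_of_mul_eq_one hsq with h | h
    · rw [h, Int.cast_one, one_mul] at hne ⊢
      rw [Real.sign_of_pos (lt_of_le_of_ne (ArchimedeanClass.stdPart_nonneg hpos.le) hne.symm),
        Int.cast_one]
    · rw [h, Int.cast_neg, Int.cast_one, neg_one_mul] at hne ⊢
      rw [Real.sign_of_neg (lt_of_le_of_ne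
        (ArchimedeanClass.stdPart_nonpos (neg_nonpos.2 hpos.le)) hne), Int.cast_neg,
        Int.cast_one]
  · rw [ArchimedeanClass.stdPart_eq_zero.2, Real.sign_zero]
    rw [hmk x hx]
    have : (w x).toNat ≠ 0 := by
      rw [Ne, ENat.toNat_eq_zero, not_or]
      exact ⟨h0, hfin x hx⟩
    exact (nsmul_pos hε this).ne'

section Chirotope

variable {r n : ℕ} {χ : (Fin (r + 1) → Fin n) → ℝ}

lemma alternating_comp_perm {k : ℕ} {χ : (Fin k → Fin n) → ℝ}
    (halt : ∀ (x : Fin k → Fin n) (i j : Fin k), i ≠ j → χ (x ∘ Equiv.swap i j) = -χ x)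
    (x : Fin k → Fin n) (σ : Equiv.Perm (Fin k)) :
    χ (x ∘ σ) = (Equiv.Perm.sign σ : ℤ) * χ x := by
  induction σ using Equiv.Perm.swap_induction_on' with
  | one => simp
  | mul_swap f i j hij ih =>
    rw [Equiv.Perm.coe_mul, ← comp_assoc, halt _ i j hij, ih, Equiv.Perm.sign_mul,
      Equiv.Perm.sign_swap hij]
    simp

lemma chirotope_eq_orderSign {k : ℕ} {χ : (Fin k → Fin n) → ℝ}
    (halt : ∀ (x : Fin k → Fin n) (i j : Fin k), i ≠ j → χ (x ∘ Equiv.swap i j) = -χ x)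
    (hrep : ∀ x : Fin k → Fin n, (∃ i j, i ≠ j ∧ x i = x j) → χ x = 0)
    (hposor : ∀ x : Fin k → Fin n, StrictMono x → χ x = 0 ∨ χ x = 1)
    {x : Fin k → Fin n} (hx : χ x ≠ 0) : χ x = orderSign x := by
  have hinj : Injective x := fun i j hij => by
    by_contra hne
    exact hx (hrep x ⟨i, j, hne, hij⟩)
  obtain ⟨σ, hσ⟩ := exists_perm_strictMono hinj
  have h1 := alternating_comp_perm halt x σ
  have h2 := orderSign_comp_perm x σ
  rw [orderSign_of_strictMono hσ] at h2
  rcases hposor _ hσ with h | h <;> rw [h] at h1 <;>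
    rcases Int.units_eq_one_or (Equiv.Perm.sign σ) with hs | hs <;>
    simp only [hs, Units.val_one, Units.val_neg, Int.cast_one, Int.cast_neg] at h1 h2
  · exact absurd (by linarith) hx
  · exact absurd (by linarith) hx
  · rw [one_mul] at h1 h2
    rw [← h1, ← h2, Int.cast_one]
  · rw [show orderSign x = -1 by linarith]
    push_cast
    linarith

lemma chirotope_exchange (hvals : ∀ x, χ x = -1 ∨ χ x = 0 ∨ χ x = 1)
    (halt : ∀ (x : Fin (r + 1) → Fin n) (i j : Fin (r + 1)), i ≠ j →
      χ (x ∘ Equiv.swap i j) = -χ x)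
    (hexch : ∀ x y : Fin (r + 1) → Fin n,
      (∀ j, 0 ≤ χ (update x 0 (y j)) * χ (update y j (x 0))) → 0 ≤ χ x * χ y)
    (x y : Fin (r + 1) → Fin n) (hx : χ x ≠ 0) (hy : χ y ≠ 0) :
    ∃ l, χ (update x 0 (y l)) * χ (update y l (x 0)) = χ x * χ y := by
  have key : ∀ y, χ x * χ y < 0 →
      ∃ l, χ (update x 0 (y l)) * χ (update y l (x 0)) = χ x * χ y := by
    intro y hxy
    obtain ⟨l, hl⟩ := not_forall.1 fun h => hxy.not_ge (hexch x y h)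
    refine ⟨l, ?_⟩
    rcases hvals x with h1 | h1 | h1 <;> rcases hvals y with h2 | h2 | h2 <;>
      rcases hvals (update x 0 (y l)) with h3 | h3 | h3 <;>
      rcases hvals (update y l (x 0)) with h4 | h4 | h4 <;>
      rw [h1, h2] at hxy <;> rw [h3, h4] at hl <;> rw [h1, h2, h3, h4] <;> norm_num at *
  rcases lt_or_gt_of_ne (mul_ne_zero hx hy) with hxy | hxy
  · exact key y hxy
  by_cases hr : ∃ i j : Fin (r + 1), i ≠ j
  · obtain ⟨i, j, hij⟩ := hr
    obtain ⟨l, hl⟩ := key (y ∘ Equiv.swap i j) (by rw [halt y i j hij]; linarith)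
    refine ⟨Equiv.swap i j l, ?_⟩
    have h : update (y ∘ Equiv.swap i j) l (x 0)
        = update y (Equiv.swap i j l) (x 0) ∘ Equiv.swap i j := by
      rw [update_comp_equiv, Equiv.symm_swap, Equiv.swap_apply_self]
    rw [h, halt _ i j hij, halt _ i j hij, comp_apply] at hl
    linarith
  · push Not at hr
    have hconst : ∀ z : Fin (r + 1) → Fin n, ∀ a, ∀ l, update z l a = fun _ => a := by
      intro z a l
      funext i
      rw [hr i l, update_self]
    refine ⟨0, ?_⟩
    have e : ∀ z : Fin (r + 1) → Fin n, (fun _ => z 0) = z := fun z =>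
      funext fun i => by rw [hr i 0]
    rw [hconst, hconst, e, e, mul_comm]

end Chirotope

/-- da Silva's conjecture (Ardila–Rincón–Williams / Speyer–Williams): every
positively oriented matroid (chirotope) is realizable, i.e. every positively
oriented matroid is a positroid. -/
theorem stmt15 (k n : ℕ) (hk : 0 < k) (hkn : k ≤ n)
    (χ : (Fin k → Fin n) → ℝ)
    (hvals : ∀ x, χ x = -1 ∨ χ x = 0 ∨ χ x = 1)
    (hnz : ∃ x, χ x ≠ 0)
    (halt : ∀ (x : Fin k → Fin n) (i j : Fin k), i ≠ j →
      χ (x ∘ Equiv.swap i j) = -χ x)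
    (hrep : ∀ x : Fin k → Fin n, (∃ i j, i ≠ j ∧ x i = x j) → χ x = 0)
    (hexch : ∀ x y : Fin k → Fin n,
      (∀ j : Fin k,
        0 ≤ χ (Function.update x ⟨0, hk⟩ (y j)) * χ (Function.update y j (x ⟨0, hk⟩))) →
      0 ≤ χ x * χ y)
    (hposor : ∀ x : Fin k → Fin n, StrictMono x → χ x = 0 ∨ χ x = 1) :
    ∃ A : Matrix (Fin k) (Fin n) ℝ, ∀ x : Fin k → Fin n,
      Real.sign ((A.submatrix id x).det) = χ x := by
  classical
  obtain ⟨r, rfl⟩ : ∃ r, k = r + 1 := ⟨k - 1, by omega⟩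
  have hsign : ∀ {x}, χ x ≠ 0 → χ x = orderSign x := chirotope_eq_orderSign halt hrep hposor
  let w : (Fin (r + 1) → Fin n) → ℕ∞ := fun x => if χ x = 0 then ⊤ else 0
  have hw0 : ∀ x, w x = 0 ↔ χ x ≠ 0 := fun x => by simp [w]
  have hwtop : ∀ x, w x ≠ ⊤ ↔ χ x ≠ 0 := fun x => by simp [w]
  have hw : IsPositiveValuation w := by
    refine ⟨fun x σ => ?_, fun x hx => ?_, fun x y hx hy => ?_⟩
    · have : χ (x ∘ σ) = 0 ↔ χ x = 0 := by simp [alternating_comp_perm halt x σ]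
      simp only [w, this]
    · obtain ⟨i, j, hij, hne⟩ := not_injective_iff.1 hx
      simp [w, hrep x ⟨i, j, hne, hij⟩]
    · rw [hwtop] at hx hy
      obtain ⟨l, hl⟩ := chirotope_exchange hvals halt hexch x y hx hy
      have hne := hl ▸ mul_ne_zero hx hy
      have h1 := left_ne_zero_of_mul hne
      have h2 := right_ne_zero_of_mul hne
      refine ⟨l, by rw [(hw0 _).2 h1, (hw0 _).2 h2, add_zero]; exact zero_le, ?_⟩
      rw [hsign hx, hsign hy, hsign h1, hsign h2] at hl
      exact_mod_cast hl
  obtain ⟨b, hb⟩ := hnz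
  obtain ⟨w', hw', hzero, hfin⟩ := hw.exists_finite ⟨b, (hwtop b).2 hb⟩
  obtain ⟨A, hA⟩ := hw'.exists_matrix hfin ⟨b, (hzero b).2 ((hw0 b).2 hb)⟩ hkn
  refine ⟨A, fun x => ?_⟩
  rw [hA, if_congr ((hzero x).trans (hw0 x)) rfl rfl]
  split_ifs with h
  · exact (hsign h).symm
  · exact (not_not.1 h).symm
end
end

section
/- Fix n ≥ 1 and 0 ≤ k ≤ n−1. The T-duality map π ↦ π̂, where π̂(i) := π(i−1) with indices taken modulo n (so in one-line notation (a_1,…,a_n) ↦ (a_n, a_1,…,a_{n−1})) and where every fixed point of π̂ is declared to be a loop, restricts to a bijection from the set of loopless decorated permutations on [n] of type (k+1, n) to the set of coloopless decorated permutations on [n] of type (k, n). -/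
noncomputable section

/-- Rotating a permutation by one position removes exactly `w (Fin.last m)` from the set of weak
anti-excedances of `w`. -/
theorem card_weak_antiexcedances_eq_succ (m : ℕ) (w : Equiv.Perm (Fin (m + 1))) :
    (Finset.univ.filter (fun i => i < w.symm i ∨ w i = i)).card =
      (Finset.univ.filter (fun i => i < (w * (finRotate (m + 1))⁻¹).symm i)).card + 1 := by
  have hsymm : ∀ i, (w * (finRotate (m + 1))⁻¹).symm i = finRotate (m + 1) (w.symm i) :=
    fun i => rfl
  have hlast : w (Fin.last m) ∉
      Finset.univ.filter (fun i => i < (w * (finRotate (m + 1))⁻¹).symm i) := by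
    simp only [Finset.mem_filter, Finset.mem_univ, true_and, hsymm, Equiv.symm_apply_apply,
      finRotate_last]
    exact Fin.not_lt_zero _
  rw [← Finset.card_insert_of_notMem hlast]
  congr 1
  ext i
  simp only [Finset.mem_filter, Finset.mem_univ, true_and, hsymm, Finset.mem_insert]
  obtain ⟨j, rfl⟩ := w.surjective i
  simp only [Equiv.symm_apply_apply, w.injective.eq_iff]
  by_cases hj : j = Fin.last m
  · subst hj
    simpa using (Fin.le_last (w (Fin.last m))).lt_or_eq
  · have hrot : (finRotate (m + 1) j : ℕ) = j + 1 := coe_finRotate_of_ne_last hj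
    simp only [hj, false_or, Fin.lt_def, hrot, Fin.ext_iff]
    omega

/-- T-duality (`π ↦ π^`, with `π^(i) = π(i-1)` cyclically) is a bijection from
loopless decorated permutations on `[n]` of type `(k+1, n)` (all fixed points
are coloops) to coloopless decorated permutations on `[n]` of type `(k, n)`
(all fixed points are loops). -/
theorem stmt16 (n k : ℕ) (hn : 1 ≤ n) (hk : k ≤ n - 1) :
    Set.BijOn (fun w : Equiv.Perm (Fin n) => w * (finRotate n)⁻¹)
      {w : Equiv.Perm (Fin n) |
        (Finset.univ.filter (fun i : Fin n => i < w.symm i ∨ w i = i)).card = k + 1}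
      {w : Equiv.Perm (Fin n) |
        (Finset.univ.filter (fun i : Fin n => i < w.symm i)).card = k} := by
  obtain ⟨m, rfl⟩ : ∃ m, n = m + 1 := ⟨n - 1, by omega⟩
  refine ⟨fun w hw => ?_, (mul_left_injective _).injOn, fun v hv => ?_⟩
  · have h := card_weak_antiexcedances_eq_succ m w
    simp only [Set.mem_ofPred_eq] at hw ⊢
    omega
  · refine ⟨v * finRotate (m + 1), ?_, mul_inv_cancel_right _ _⟩
    have h := card_weak_antiexcedances_eq_succ m (v * finRotate (m + 1))
    rw [mul_inv_cancel_right] at h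
    simp only [Set.mem_ofPred_eq] at hv ⊢
    omega
end
end

section
/- Fix 0 ≤ k ≤ n−1. The number of permutations w ∈ S_n with w_n = n and exactly k+1 cyclic left descents equals the Eulerian number E_{k,n−1} = Σ_{ℓ=0}^{k+1} (−1)^ℓ · C(n,ℓ) · (k+1−ℓ)^{n−1}; that is, |D_{k+1,n}| = E_{k,n−1}. -/
noncomputable section

/-- The set of cyclic left descents of `w` (with values recorded 0-based:
the value `i ∈ [n]` corresponds to `i - 1 : Fin n`). -/
def cdes {n : ℕ} (w : Equiv.Perm (Fin n)) : Finset (Fin n) :=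
  Finset.univ.filter (fun i =>
    (i.val = 0 ∧ w.symm i < w.symm
        ⟨n - 1, Nat.sub_lt (Nat.lt_of_le_of_lt (Nat.zero_le _) i.isLt) Nat.one_pos⟩) ∨
    (i.val ≠ 0 ∧ w.symm i < w.symm
        ⟨i.val - 1, Nat.lt_of_le_of_lt (Nat.sub_le _ _) i.isLt⟩))

/-- The cyclic rotation of (the one-line notation of) `w` whose last entry is
the value `a`. -/
def rotTo {n : ℕ} (w : Equiv.Perm (Fin n)) (a : Fin n) : Equiv.Perm (Fin n) :=
  w * (finRotate n) ^ ((w.symm a).val + 1)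

/-- `Iset w q` is the set `I_{q+1}(w)` (0-based indexing): `I_1(w) = cdes w`
and `I_r(w) = cdes (w^{(r-1)})` for `2 ≤ r ≤ n`. -/
def Iset {n : ℕ} (w : Equiv.Perm (Fin n)) (q : Fin n) : Finset (Fin n) :=
  if _h : q.val = 0 then cdes w
  else cdes (rotTo w ⟨q.val - 1, Nat.lt_of_le_of_lt (Nat.sub_le _ _) q.isLt⟩)

/-- The cyclic descents of `u`, regarded as a cyclic word: the positions `i` with
`u i < u (i - 1)`, where `0 - 1` is the last position. -/
def cyclicDescents {m : ℕ} (u : Equiv.Perm (Fin (m + 1))) : Finset (Fin (m + 1)) :=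
  Finset.univ.filter (fun i => u i < u (i - 1))

/-- Insert a new smallest value into the word `u`, just before position `p`. -/
def insertMin {m : ℕ} (u : Equiv.Perm (Fin (m + 1))) (p : Fin (m + 1)) :
    Equiv.Perm (Fin (m + 2)) :=
  (finSuccEquiv' p.castSucc).trans ((Equiv.optionCongr u).trans (finSuccEquiv' 0).symm)

/-- The permutations fixing the last position, with `d` cyclic descents. -/
def fixLastWithDescents (m d : ℕ) : Finset (Equiv.Perm (Fin (m + 1))) :=
  Finset.univ.filter (fun u => u (Fin.last m) = Fin.last m ∧ (cyclicDescents u).card = d)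

/-- The alternating sum for Eulerian numbers, in terms of the number `d` of cyclic descents. -/
def eulerianSum (n d : ℕ) : ℤ :=
  ∑ l ∈ Finset.range (d + 1), (-1 : ℤ) ^ l * (n.choose l : ℤ) * ((d : ℤ) - (l : ℤ)) ^ (n - 1)

theorem insertMin_self {m : ℕ} (u : Equiv.Perm (Fin (m + 1))) (p : Fin (m + 1)) :
    insertMin u p p.castSucc = 0 := by
  simp [insertMin]

theorem insertMin_succAbove {m : ℕ} (u : Equiv.Perm (Fin (m + 1))) (p j : Fin (m + 1)) :
    insertMin u p (p.castSucc.succAbove j) = (u j).succ := by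
  simp [insertMin]

theorem insertMin_last {m : ℕ} (u : Equiv.Perm (Fin (m + 1))) (p : Fin (m + 1)) :
    insertMin u p (Fin.last (m + 1)) = (u (Fin.last m)).succ := by
  rw [← insertMin_succAbove u p, Fin.succAbove_of_le_castSucc _ _ (by simp [Fin.le_last]),
    Fin.succ_last]

theorem insertMin_injective {m : ℕ} {u v : Equiv.Perm (Fin (m + 1))} {p q : Fin (m + 1)}
    (h : insertMin u p = insertMin v q) : u = v ∧ p = q := by
  have hpq : p = q := by
    apply Fin.castSucc_injective
    apply (insertMin v q).injective
    rw [insertMin_self, ← h, insertMin_self]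
  subst hpq
  refine ⟨Equiv.ext fun j => Fin.succ_injective _ ?_, rfl⟩
  rw [← insertMin_succAbove u p, h, insertMin_succAbove]

theorem exists_insertMin {m : ℕ} (w : Equiv.Perm (Fin (m + 2)))
    (hw : w (Fin.last (m + 1)) = Fin.last (m + 1)) :
    ∃ u p, u (Fin.last m) = Fin.last m ∧ insertMin u p = w := by
  have hne : w.symm 0 ≠ Fin.last (m + 1) := by
    intro h
    rw [Equiv.symm_apply_eq, hw] at h
    exact absurd h.symm (Fin.last_pos.ne')
  obtain ⟨p, hp⟩ := Fin.exists_castSucc_eq.2 hne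
  let e : Option (Fin (m + 1)) ≃ Option (Fin (m + 1)) :=
    (finSuccEquiv' p.castSucc).symm.trans (w.trans (finSuccEquiv' 0))
  have he : e none = none := by simp [e, hp]
  have heq : insertMin (Equiv.removeNone e) p = w := by
    have : Equiv.optionCongr (Equiv.removeNone e) = e := by
      ext1 x
      cases x with
      | none => simp [he]
      | some x =>
        simp only [Equiv.optionCongr_apply, Option.map_some]
        refine Equiv.removeNone_some e (Option.ne_none_iff_exists'.1 fun hx => ?_)
        exact Option.some_ne_none x (e.injective (hx.trans he.symm))
    ext1 x
    simp [insertMin, this, e]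
  refine ⟨Equiv.removeNone e, p, ?_, heq⟩
  rw [← heq, insertMin_last, ← Fin.succ_last] at hw
  exact Fin.succ_injective _ hw

theorem fin_zero_sub_one (m : ℕ) : (0 : Fin (m + 1)) - 1 = Fin.last m := by
  rw [zero_sub]
  exact Fin.ext Fin.coe_neg_one

theorem fin_succ_sub_one {m : ℕ} (j : Fin m) : j.succ - 1 = j.castSucc := by
  cases m with
  | zero => exact j.elim0
  | succ m => rw [sub_eq_iff_eq_add, Fin.coeSucc_eq_succ]

theorem succAbove_castSucc_self_sub_one {m : ℕ} (p : Fin (m + 1)) :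
    p.castSucc.succAbove p - 1 = p.castSucc := by
  rw [Fin.succAbove_castSucc_self, fin_succ_sub_one]

theorem succAbove_castSucc_sub_one {m : ℕ} {p j : Fin (m + 1)} (h : j ≠ p) :
    p.castSucc.succAbove j - 1 = p.castSucc.succAbove (j - 1) := by
  rcases lt_or_gt_of_ne h with h | h
  · rw [Fin.succAbove_castSucc_of_lt _ _ h]
    cases j using Fin.cases with
    | zero =>
      rw [Fin.castSucc_zero, fin_zero_sub_one, fin_zero_sub_one,
        Fin.succAbove_castSucc_of_le _ _ (Fin.le_last p), Fin.succ_last]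
    | succ j =>
      rw [← Fin.succ_castSucc, fin_succ_sub_one, fin_succ_sub_one,
        Fin.succAbove_castSucc_of_lt _ _ (Fin.castSucc_lt_succ.trans h)]
  · rw [Fin.succAbove_castSucc_of_le _ _ h.le]
    cases j using Fin.cases with
    | zero => exact absurd h (Fin.not_lt_zero p)
    | succ j =>
      rw [fin_succ_sub_one, fin_succ_sub_one, Fin.succAbove_castSucc_of_le _ _
        (Fin.le_castSucc_iff.2 h), Fin.succ_castSucc]

theorem card_cyclicDescents_insertMin {m : ℕ} (u : Equiv.Perm (Fin (m + 1))) (p : Fin (m + 1)) :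
    (cyclicDescents (insertMin u p)).card = ((cyclicDescents u).erase p).card + 1 := by
  have hpos : 0 < insertMin u p (p.castSucc - 1) := by
    rw [Fin.pos_iff_ne_zero, ← insertMin_self u p, (insertMin u p).injective.ne_iff]
    simp
  have key (j : Fin (m + 1)) :
      insertMin u p (p.castSucc.succAbove j) < insertMin u p (p.castSucc.succAbove j - 1) ↔
        j ∈ (cyclicDescents u).erase p := by
    by_cases h : j = p
    · subst h
      rw [succAbove_castSucc_self_sub_one, insertMin_self]
      simp
    · simp [succAbove_castSucc_sub_one h, insertMin_succAbove, cyclicDescents, h]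
  rw [cyclicDescents, Finset.card_filter, Fin.sum_univ_succAbove _ p.castSucc, insertMin_self,
    if_pos hpos]
  simp only [key]
  rw [add_comm, ← Finset.card_filter, Finset.filter_univ_mem]

theorem card_filter_card_erase {α : Type*} [Fintype α] [DecidableEq α] (s : Finset α) (d : ℕ) :
    ((Finset.univ.filter (fun p => (s.erase p).card = d)).card : ℤ) =
      (d + 1) * (if s.card = d + 1 then 1 else 0) +
        (Fintype.card α - d) * (if s.card = d then 1 else 0) := by
  have hs (p : α) : (s.erase p).card = d ↔ (p ∈ s ∧ s.card = d + 1) ∨ (p ∉ s ∧ s.card = d) := by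
    by_cases hp : p ∈ s
    · have := Finset.card_erase_add_one hp
      simp only [hp, true_and, not_true, false_and, or_false]
      omega
    · simp [hp]
  simp only [hs]
  by_cases h1 : s.card = d + 1
  · simp [h1]
  · by_cases h2 : s.card = d
    · have := Finset.card_add_card_compl s
      simp [h2, ← Finset.compl_filter]
      omega
    · simp [h1, h2]

theorem card_fixLastWithDescents_succ (m d : ℕ) :
    ((fixLastWithDescents (m + 1) (d + 1)).card : ℤ) =
      (d + 1) * (fixLastWithDescents m (d + 1)).card +
        (m + 1 - d) * (fixLastWithDescents m d).card := by
  let F := Finset.univ.filter (fun u : Equiv.Perm (Fin (m + 1)) => u (Fin.last m) = Fin.last m)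
  have hF (c : ℕ) : fixLastWithDescents m c = F.filter (fun u => (cyclicDescents u).card = c) := by
    rw [Finset.filter_filter, fixLastWithDescents]
  have hsigma : (fixLastWithDescents (m + 1) (d + 1)).card =
      (F.sigma fun u => Finset.univ.filter
        (fun p => ((cyclicDescents u).erase p).card = d)).card := by
    symm
    refine Finset.card_bij (fun x _ => insertMin x.1 x.2) ?_ ?_ ?_
    · rintro ⟨u, p⟩ h
      simp only [F, Finset.mem_sigma, Finset.mem_filter, Finset.mem_univ, true_and] at h
      simp [fixLastWithDescents, insertMin_last, card_cyclicDescents_insertMin, h]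
    · rintro ⟨u, p⟩ _ ⟨v, q⟩ _ h
      obtain ⟨rfl, rfl⟩ := insertMin_injective h
      rfl
    · intro w hw
      simp only [fixLastWithDescents, Finset.mem_filter, Finset.mem_univ, true_and] at hw
      obtain ⟨u, p, hu, rfl⟩ := exists_insertMin w hw.1
      rw [card_cyclicDescents_insertMin] at hw
      exact ⟨⟨u, p⟩, by simpa [F, hu] using hw.2, rfl⟩
  rw [hsigma, Finset.card_sigma, Nat.cast_sum]
  simp only [card_filter_card_erase, Finset.sum_add_distrib, ← Finset.mul_sum]
  simp [hF]

theorem fixLastWithDescents_zero_right (m : ℕ) : fixLastWithDescents (m + 1) 0 = ∅ := by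
  refine Finset.eq_empty_of_forall_notMem fun w hw => ?_
  simp only [fixLastWithDescents, Finset.mem_filter, Finset.mem_univ, true_and] at hw
  obtain ⟨u, p, -, rfl⟩ := exists_insertMin w hw.1
  rw [card_cyclicDescents_insertMin] at hw
  omega

theorem eulerianSum_succ (m d : ℕ) :
    eulerianSum (m + 2) (d + 1) =
      (d + 1) * eulerianSum (m + 1) (d + 1) + (m + 1 - d) * eulerianSum (m + 1) d := by
  have hchoose (l : ℕ) :
      ((m + 1).choose (l + 1) : ℤ) * (l + 1) = (m + 1).choose l * (m + 1 - l) := by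
    rcases le_or_gt l (m + 1) with h | h
    · have := Nat.choose_succ_right_eq (m + 1) l
      zify [h] at this
      exact this
    · simp [Nat.choose_eq_zero_of_lt h, Nat.choose_eq_zero_of_lt (h.trans (Nat.lt_succ_self l))]
  simp only [eulerianSum]
  rw [Finset.sum_range_succ' _ (d + 1), Finset.sum_range_succ' _ (d + 1), mul_add, Finset.mul_sum,
    Finset.mul_sum, add_right_comm, ← Finset.sum_add_distrib]
  congr 1
  · refine Finset.sum_congr rfl fun l _ => ?_
    simp only [Nat.add_sub_cancel, show m + 2 - 1 = m + 1 from rfl]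
    rw [Nat.choose_succ_succ (m + 1) l]
    push_cast
    linear_combination (-1 : ℤ) ^ l * ((d : ℤ) - l) ^ m * hchoose l
  · simp [pow_succ']

theorem card_fixLastWithDescents (m d : ℕ) :
    ((fixLastWithDescents m d).card : ℤ) = eulerianSum (m + 1) d := by
  induction m generalizing d with
  | zero =>
    rcases d with _ | d
    · simp [fixLastWithDescents, cyclicDescents, eulerianSum, Subsingleton.elim _ (0 : Fin 1)]
    · have : ∑ l ∈ Finset.range d, (-1 : ℤ) ^ (l + 2) * (Nat.choose 1 (l + 2) : ℤ) = 0 :=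
        Finset.sum_eq_zero fun l _ => by simp [Nat.choose_eq_zero_of_lt]
      simp [fixLastWithDescents, cyclicDescents, eulerianSum, Finset.sum_range_succ', this]
  | succ m ih =>
    rcases d with _ | d
    · simp [fixLastWithDescents_zero_right, eulerianSum]
    · rw [card_fixLastWithDescents_succ, ih, ih, eulerianSum_succ]

theorem cdes_eq_cyclicDescents {m : ℕ} (w : Equiv.Perm (Fin (m + 1))) :
    cdes w = cyclicDescents w.symm := by
  ext i
  simp only [cdes, cyclicDescents, Finset.mem_filter, Finset.mem_univ, true_and]
  cases i using Fin.cases with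
  | zero =>
    rw [fin_zero_sub_one]
    simp [Fin.last]
  | succ j =>
    rw [fin_succ_sub_one]
    simp [Fin.castSucc, Fin.castAdd, Fin.castLE]

/-- The number of permutations `w ∈ S_n` with `w_n = n` and exactly `k + 1`
cyclic left descents is the Eulerian number `E_{k, n-1}`. -/
theorem stmt18 (n k : ℕ) (hn : 0 < n) (hk : k ≤ n - 1) :
    ((Finset.univ.filter (fun w : Equiv.Perm (Fin n) =>
        w ⟨n - 1, Nat.sub_lt hn Nat.one_pos⟩ = ⟨n - 1, Nat.sub_lt hn Nat.one_pos⟩ ∧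
        (cdes w).card = k + 1)).card : ℤ) =
      ∑ l ∈ Finset.range (k + 2),
        (-1 : ℤ) ^ l * (n.choose l : ℤ) * ((k : ℤ) + 1 - (l : ℤ)) ^ (n - 1) := by
  obtain ⟨m, rfl⟩ : ∃ m, n = m + 1 := ⟨n - 1, by omega⟩
  have hcard : (Finset.univ.filter (fun w : Equiv.Perm (Fin (m + 1)) =>
        w ⟨m + 1 - 1, Nat.sub_lt hn Nat.one_pos⟩ = ⟨m + 1 - 1, Nat.sub_lt hn Nat.one_pos⟩ ∧
        (cdes w).card = k + 1)).card = (fixLastWithDescents m (k + 1)).card := by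
    refine Finset.card_equiv (Equiv.inv _) fun w => ?_
    simp only [fixLastWithDescents, Finset.mem_filter, Finset.mem_univ, true_and,
      cdes_eq_cyclicDescents, Equiv.inv_apply, Equiv.Perm.inv_def, Equiv.symm_apply_eq]
    exact and_congr_left fun _ => eq_comm
  rw [hcard, card_fixLastWithDescents, eulerianSum]
  push_cast
  rfl
end
end
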